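/- arXiv:1812.03695 — 2 statements merged into one kernel-verified Lean document; each statement's English description precedes it below -/
import Mathlib

section
/- Fix N ≥ 1, real parameters λ, μ with λμ(λ−μ)(λ+μ) ≠ 0, and reals m_k, m̄_k, c_k, c̄_k (k = 1,…,N) such that m̄_j ≠ m_k and m_j ≠ m̄_k for all j,k, and m_k, m̄_k ∉ {λ,−λ,μ,−μ} for all k. Then the function ω(x,y,n₁,n₂) = exp(φ(x,y,n₁,n₂))·det(1 + A(x,y,n₁,n₂)·Ā(x,y,n₁,n₂)) satisfies the bilinear (2+2)-dimensional Toda lattice: for all x,y ∈ ℝ and n₁,n₂ ∈ ℤ, ω·(∂²ω/∂x∂y) − (∂ω/∂x)·(∂ω/∂y) = ω(x,y,n₁−1,n₂)·ω(x,y,n₁+1,n₂) − ω(x,y,n₁,n₂−1)·ω(x,y,n₁,n₂+1), where the derivatives are partial derivatives in the continuous variables. -/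
open Matrix Real

noncomputable section

/-- `h_ζ(s) = (s-ζ)/(s+ζ)` -/
def solh (ζ s : ℝ) : ℝ := (s - ζ) / (s + ζ)

/-- `h̄_ζ(s) = (s+ζ)/(s-ζ)` -/
def solhb (ζ s : ℝ) : ℝ := (s + ζ) / (s - ζ)

/-- `l_ζ(s) = h_ζ(s) - 1/h_ζ(s)` -/
def soll (ζ s : ℝ) : ℝ := solh ζ s - 1 / solh ζ s

/-- `l̄_ζ(s) = h̄_ζ(s) - 1/h̄_ζ(s)` -/
def sollb (ζ s : ℝ) : ℝ := solhb ζ s - 1 / solhb ζ s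

/-- The matrix `A(x,y,n₁,n₂)`. -/
def solA (N : ℕ) (lam mu : ℝ) (m mb c : Fin N → ℝ) (x y : ℝ) (n₁ n₂ : ℤ) :
    Matrix (Fin N) (Fin N) ℝ :=
  Matrix.of fun j k =>
    c k / (mb j - m k) * Real.exp (x * soll lam (m k) + y * soll mu (m k)) *
      (solh lam (m k)) ^ (n₁ + n₂) * (solh mu (m k)) ^ (n₂ - n₁)

/-- The matrix `Ā(x,y,n₁,n₂)`. -/
def solAb (N : ℕ) (lam mu : ℝ) (m mb cb : Fin N → ℝ) (x y : ℝ) (n₁ n₂ : ℤ) :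
    Matrix (Fin N) (Fin N) ℝ :=
  Matrix.of fun j k =>
    cb k / (m j - mb k) * Real.exp (x * sollb lam (mb k) + y * sollb mu (mb k)) *
      (solhb lam (mb k)) ^ (n₁ + n₂) * (solhb mu (mb k)) ^ (n₂ - n₁)

/-- The background `φ(x,y,n₁,n₂)`. -/
def solPhi (lam mu : ℝ) (x y : ℝ) (n₁ n₂ : ℤ) : ℝ :=
  8 * x * y * (lam * mu * (lam ^ 2 + mu ^ 2) / (lam ^ 2 - mu ^ 2) ^ 2) +
    ((n₁ : ℝ) ^ 2 - (n₂ : ℝ) ^ 2) * Real.log |(lam + mu) / (lam - mu)|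

section MatrixCalculus

variable {ι : Type*} [Fintype ι] [DecidableEq ι]

/-- Jacobi's formula along a differentiable curve of matrices. -/
theorem Matrix.hasDerivAt_det {M : ℝ → Matrix ι ι ℝ} {M' : Matrix ι ι ℝ} {t : ℝ}
    (hM : ∀ i j, HasDerivAt (fun s => M s i j) (M' i j) t) :
    HasDerivAt (fun s => (M s).det) (trace (adjugate (M t) * M')) t := by
  have h1 : HasDerivAt (fun s => ∑ σ : Equiv.Perm ι,
      (Equiv.Perm.sign σ : ℝ) * ∏ i, M s (σ i) i)
      (∑ σ : Equiv.Perm ι, (Equiv.Perm.sign σ : ℝ) *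
        ∑ i, (∏ j ∈ Finset.univ.erase i, M t (σ j) j) • M' (σ i) i) t :=
    HasDerivAt.fun_sum fun σ _ =>
      (HasDerivAt.fun_finsetProd fun i _ => hM (σ i) i).const_mul _
  have h2 : trace (adjugate (M t) * M') = ∑ i, ((M t).updateCol i fun k => M' k i).det := by
    refine Finset.sum_congr rfl fun i _ => ?_
    rw [← cramer_apply, cramer_eq_adjugate_mulVec]
    rfl
  convert! h1 using 1
  · funext s
    exact det_apply' _
  · rw [h2]
    simp_rw [det_apply', Finset.mul_sum]
    rw [Finset.sum_comm]
    refine Finset.sum_congr rfl fun σ _ => Finset.sum_congr rfl fun i _ => ?_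
    rw [← Finset.prod_erase_mul _ _ (Finset.mem_univ i), updateCol_self, smul_eq_mul]
    congr 2
    refine Finset.prod_congr rfl fun j hj => ?_
    rw [updateCol_ne (Finset.ne_of_mem_erase hj)]

/-- The directional derivative of the adjugate at `G` in the direction `H`. -/
noncomputable def Matrix.adjugateDeriv (G H : Matrix ι ι ℝ) : Matrix ι ι ℝ :=
  of fun i j => trace (adjugate (G.updateRow j (Pi.single i 1)) * H.updateRow j 0)

theorem Matrix.hasDerivAt_adjugate {M : ℝ → Matrix ι ι ℝ} {M' : Matrix ι ι ℝ} {t : ℝ}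
    (hM : ∀ i j, HasDerivAt (fun s => M s i j) (M' i j) t) (i j : ι) :
    HasDerivAt (fun s => adjugate (M s) i j) (adjugateDeriv (M t) M' i j) t := by
  simp_rw [adjugate_apply]
  refine hasDerivAt_det fun k l => ?_
  rcases eq_or_ne k j with rfl | hk
  · simpa using hasDerivAt_const t _
  · simpa [updateRow_ne hk] using hM k l

omit [DecidableEq ι] in
theorem Matrix.hasDerivAt_mul_apply {M P : ℝ → Matrix ι ι ℝ} {M' P' : Matrix ι ι ℝ} {t : ℝ}
    (hM : ∀ i j, HasDerivAt (fun s => M s i j) (M' i j) t)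
    (hP : ∀ i j, HasDerivAt (fun s => P s i j) (P' i j) t) (i j : ι) :
    HasDerivAt (fun s => (M s * P s) i j) ((M' * P t + M t * P') i j) t := by
  simp only [Matrix.add_apply, mul_apply, ← Finset.sum_add_distrib]
  exact HasDerivAt.fun_sum fun k _ => (hM i k).mul (hP k j)

theorem Matrix.adjugateDeriv_mul_add (G H : Matrix ι ι ℝ) :
    adjugateDeriv G H * G + adjugate G * H = trace (adjugate G * H) • 1 := by
  have hM : ∀ i j, HasDerivAt (fun s : ℝ => (G + s • H) i j) (H i j) 0 := fun i j => by
    simpa using ((hasDerivAt_id (0 : ℝ)).mul_const (H i j)).const_add (G i j)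
  ext i j
  have h1 := hasDerivAt_mul_apply (hasDerivAt_adjugate hM) hM i j
  have h2 := (hasDerivAt_det hM).mul_const ((1 : Matrix ι ι ℝ) i j)
  simp only [adjugate_mul, zero_smul, add_zero, smul_apply, smul_eq_mul] at h1 h2 ⊢
  exact h1.unique h2

theorem Matrix.adjugateDeriv_eq {G : Matrix ι ι ℝ} (hG : G.det ≠ 0) (H : Matrix ι ι ℝ) :
    adjugateDeriv G H = G.det • (trace (G⁻¹ * H) • G⁻¹ - G⁻¹ * H * G⁻¹) := by
  have hu : IsUnit G.det := isUnit_iff_ne_zero.2 hG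
  have hadj : adjugate G = G.det • G⁻¹ := by
    rw [Matrix.inv_def, smul_smul, Ring.mul_inverse_cancel _ hu, one_smul]
  have h := congrArg (· * G⁻¹) (eq_sub_of_add_eq (adjugateDeriv_mul_add G H))
  simp only [Matrix.mul_assoc, Matrix.mul_nonsing_inv _ hu, Matrix.mul_one] at h
  rw [h, hadj]
  simp only [smul_mul_assoc, trace_smul, sub_mul, one_mul, smul_sub, smul_smul, smul_eq_mul]

theorem Matrix.adjugateDeriv_bilinear_eq {G : Matrix ι ι ℝ} (hG : G.det ≠ 0)
    (G₁ G₂ G₁₂ : Matrix ι ι ℝ) :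
    G.det * trace (adjugateDeriv G G₁ * G₂ + adjugate G * G₁₂) -
        trace (adjugate G * G₁) * trace (adjugate G * G₂) =
      G.det ^ 2 * (trace (G⁻¹ * G₁₂) - trace (G⁻¹ * G₁ * (G⁻¹ * G₂))) := by
  have hadj : adjugate G = G.det • G⁻¹ := by
    rw [Matrix.inv_def, smul_smul, Ring.mul_inverse_cancel _ (isUnit_iff_ne_zero.2 hG), one_smul]
  rw [adjugateDeriv_eq hG, hadj]
  simp only [smul_mul_assoc, trace_smul, sub_mul, smul_eq_mul, trace_add, trace_sub, smul_sub,
    Matrix.mul_assoc]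
  ring

theorem Matrix.continuous_adjugateDeriv {X : Type*} [TopologicalSpace X]
    {G H : X → Matrix ι ι ℝ} (hG : Continuous G) (hH : Continuous H) :
    Continuous fun x => adjugateDeriv (G x) (H x) :=
  continuous_matrix fun _ j =>
    ((hG.matrix_updateRow j continuous_const).matrix_adjugate.matrix_mul
      (hH.matrix_updateRow j continuous_const)).matrix_trace

theorem Matrix.dense_det_one_add_smul_ne_zero (X : Matrix ι ι ℝ) :
    Dense {ε : ℝ | (1 + ε • X).det ≠ 0} := by
  obtain ⟨p, hp⟩ : ∃ p : Polynomial ℝ,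
      p = (1 + (Polynomial.X : Polynomial ℝ) • X.map Polynomial.C).det := ⟨_, rfl⟩
  have heval : ∀ ε, p.eval ε = (1 + ε • X).det := fun ε => by
    rw [hp, ← Polynomial.coe_evalRingHom, RingHom.map_det]
    congr 1
    ext i j
    simpa [Matrix.one_apply, apply_ite (Polynomial.eval ε)] using mul_comm _ _
  have hp0 : p ≠ 0 := fun h => by
    simpa [h] using heval 0
  have : {ε : ℝ | (1 + ε • X).det ≠ 0} = ((p.roots.toFinset : Set ℝ))ᶜ := by
    ext ε
    simp [hp0, heval]
  rw [this]
  exact (Finset.countable_toSet _).dense_compl ℝ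

end MatrixCalculus

section CauchyLike

variable {ι : Type*} [Fintype ι] [DecidableEq ι]

/-- The vector `v / (s - p)`, entrywise. -/
def resolventVec (v s : ι → ℝ) (p : ℝ) : ι → ℝ := fun j => v j / (s j - p)

/-- The Cauchy-like matrix with entries `v j * w k / (s j - t k)`. -/
def cauchyLike (v s w t : ι → ℝ) : Matrix ι ι ℝ := of fun j k => v j * w k / (s j - t k)

/-- The two-point function of the Cauchy-like pair `A`, `B`, with `S = B (1 + A B)⁻¹`. -/
def twoPoint (g b a m : ι → ℝ) (S : Matrix ι ι ℝ) (p q : ℝ) : ℝ :=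
  1 - (p - q) * (resolventVec a m q ⬝ᵥ S *ᵥ resolventVec g b p)

omit [DecidableEq ι] in
theorem trace_vecMulVec_mul (u v : ι → ℝ) (S : Matrix ι ι ℝ) :
    trace (vecMulVec u v * S) = v ⬝ᵥ S *ᵥ u := by
  rw [trace_mul_comm, mul_vecMulVec, trace_vecMulVec, dotProduct_comm]

theorem cauchyLike_sylvester {v s w t : ι → ℝ} (h : ∀ j k, s j ≠ t k) :
    diagonal s * cauchyLike v s w t = cauchyLike v s w t * diagonal t + vecMulVec v w := by
  ext j k
  have := sub_ne_zero.2 (h j k)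
  simp only [cauchyLike, Matrix.add_apply, diagonal_mul, mul_diagonal, vecMulVec_apply, of_apply]
  field_simp
  ring

theorem diagonal_mulVec_resolventVec {v s : ι → ℝ} {p : ℝ} (h : ∀ j, s j ≠ p) :
    diagonal s *ᵥ resolventVec v s p = p • resolventVec v s p + v := by
  ext j
  have := sub_ne_zero.2 (h j)
  simp only [mulVec_diagonal, resolventVec, Pi.add_apply, Pi.smul_apply, smul_eq_mul]
  field_simp
  ring

theorem resolvent_commutator {b m : ι → ℝ} (g a f d : ι → ℝ) (hbm : ∀ j k, b j ≠ m k)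
    (hdet : (1 + cauchyLike g b a m * cauchyLike f m d b).det ≠ 0) (S R : Matrix ι ι ℝ)
    (hR : R = (1 + cauchyLike g b a m * cauchyLike f m d b)⁻¹)
    (hS : S = cauchyLike f m d b * R) :
    S * diagonal b - diagonal m * S =
      S * vecMulVec g a * S - (1 - S * cauchyLike g b a m) * vecMulVec f d * R := by
  have h1 := cauchyLike_sylvester (v := g) (w := a) hbm
  have h2 := cauchyLike_sylvester (v := f) (w := d) fun j k => (hbm k j).symm
  set A := cauchyLike g b a m
  set B := cauchyLike f m d b
  have hu : IsUnit (1 + A * B).det := isUnit_iff_ne_zero.2 hdet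
  have hRG : R * (1 + A * B) = 1 := hR ▸ Matrix.nonsing_inv_mul _ hu
  have hGR : (1 + A * B) * R = 1 := hR ▸ Matrix.mul_nonsing_inv _ hu
  have hSG : S * (1 + A * B) = B := by rw [hS, Matrix.mul_assoc, hRG, Matrix.mul_one]
  have key : (S * diagonal b - diagonal m * S) * (1 + A * B) =
      (S * vecMulVec g a * S - (1 - S * A) * vecMulVec f d * R) * (1 + A * B) := by
    have e1 : (S * diagonal b - diagonal m * S) * (1 + A * B) =
        S * diagonal b + S * (diagonal b * A) * B - diagonal m * (S * (1 + A * B)) := by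
      noncomm_ring
    have e2 : (S * vecMulVec g a * S - (1 - S * A) * vecMulVec f d * R) * (1 + A * B) =
        S * vecMulVec g a * (S * (1 + A * B)) -
          (1 - S * A) * vecMulVec f d * (R * (1 + A * B)) := by
      noncomm_ring
    rw [e1, e2, hRG, hSG, h1, h2]
    rw [← sub_eq_zero]
    have e3 : S * diagonal b + S * (A * diagonal m + vecMulVec g a) * B -
          (B * diagonal b + vecMulVec f d) -
          (S * vecMulVec g a * B - (1 - S * A) * vecMulVec f d * 1) =
        S * diagonal b + S * A * (diagonal m * B) -
          (B * diagonal b + vecMulVec f d) + (1 - S * A) * vecMulVec f d := by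
      noncomm_ring
    have e4 : S * diagonal b + S * A * (B * diagonal b + vecMulVec f d) -
          (B * diagonal b + vecMulVec f d) + (1 - S * A) * vecMulVec f d =
        S * (1 + A * B) * diagonal b - B * diagonal b := by
      noncomm_ring
    rw [e3, h2, e4, hSG, sub_self]
  have := congrArg (· * R) key
  simpa only [Matrix.mul_assoc, hGR, Matrix.mul_one] using this

theorem exists_twoPoint_eq_wedge {b m : ι → ℝ} (g a f d : ι → ℝ) (hbm : ∀ j k, b j ≠ m k)
    (hdet : (1 + cauchyLike g b a m * cauchyLike f m d b).det ≠ 0) {S : Matrix ι ι ℝ}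
    (hS : S = cauchyLike f m d b * (1 + cauchyLike g b a m * cauchyLike f m d b)⁻¹) :
    ∃ u₁ u₂ w₁ w₂ : ℝ → ℝ, ∀ p q, (∀ j, b j ≠ p) → (∀ k, m k ≠ q) →
      twoPoint g b a m S p q = u₁ p * w₂ q - u₂ p * w₁ q := by
  set R := (1 + cauchyLike g b a m * cauchyLike f m d b)⁻¹ with hR
  refine ⟨fun p => 1 - a ⬝ᵥ S *ᵥ resolventVec g b p, fun p => -(d ⬝ᵥ R *ᵥ resolventVec g b p),
    fun q => resolventVec a m q ⬝ᵥ (1 - S * cauchyLike g b a m) *ᵥ f,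
    fun q => 1 + resolventVec a m q ⬝ᵥ S *ᵥ g, fun p q hp hq => ?_⟩
  have hc := congrArg (fun M => resolventVec a m q ⬝ᵥ M *ᵥ resolventVec g b p)
    (resolvent_commutator g a f d hbm hdet S R hR hS)
  have hα : resolventVec a m q ᵥ* diagonal m = q • resolventVec a m q + a := by
    rw [← diagonal_mulVec_resolventVec hq, ← mulVec_transpose, diagonal_transpose]
  simp only [sub_mulVec, dotProduct_sub, ← mulVec_mulVec, vecMulVec_mulVec,
    diagonal_mulVec_resolventVec hp, mulVec_add, mulVec_smul, dotProduct_add, dotProduct_smul,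
    dotProduct_mulVec (resolventVec a m q) (diagonal m), hα, add_dotProduct, smul_dotProduct,
    op_smul_eq_smul, smul_eq_mul] at hc
  simp only [twoPoint, sub_mulVec, dotProduct_sub, ← mulVec_mulVec]
  linear_combination -hc

/-- The effect on `det (1 + A B)` of multiplying `A` by a quotient of four linear factors. -/
theorem det_one_add_shift {b m : ι → ℝ} (g a : ι → ℝ) (hbm : ∀ j k, b j ≠ m k)
    {A A' B S : Matrix ι ι ℝ} (hA : A = cauchyLike g b a m)
    (hdet : (1 + A * B).det ≠ 0) (hS : S = B * (1 + A * B)⁻¹) {p q r s : ℝ}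
    (hbp : ∀ j, b j ≠ p) (hbr : ∀ j, b j ≠ r) (hmq : ∀ k, m k ≠ q) (hms : ∀ k, m k ≠ s)
    (hpr : p ≠ r) (hqs : s ≠ q)
    (hA' : ∀ j k, A' j k = A j k * ((m k - p) * (m k - r) * ((b j - q) * (b j - s)) /
      ((b j - p) * (b j - r) * ((m k - q) * (m k - s))))) :
    (1 + A' * B).det = (1 + A * B).det *
      ((twoPoint g b a m S p q * twoPoint g b a m S r s * ((p - s) * (r - q)) -
        twoPoint g b a m S p s * twoPoint g b a m S r q * ((p - q) * (r - s))) /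
        ((p - r) * (s - q))) := by
  have hpr' := sub_ne_zero.2 hpr
  have hqs' := sub_ne_zero.2 hqs
  set U : Matrix ι (Fin 2) ℝ := of fun j i => resolventVec g b (![p, r] i) j with hU
  set Q : Matrix (Fin 2) ι ℝ := of fun i k => resolventVec a m (![q, s] i) k with hQ
  set C : Matrix (Fin 2) (Fin 2) ℝ :=
    !![-((p - s) * (q - p) * (q - r) / ((p - r) * (s - q))),
        (p - q) * (s - p) * (s - r) / ((p - r) * (s - q));
        (r - s) * (q - r) * (q - p) / ((p - r) * (s - q)),
        -((r - q) * (s - r) * (s - p) / ((p - r) * (s - q)))] with hC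
  have hAA : A' = A + U * (C * Q) := by
    ext j k
    have h1 := sub_ne_zero.2 (hbm j k)
    have h2 := sub_ne_zero.2 (hbp j)
    have h3 := sub_ne_zero.2 (hbr j)
    have h4 := sub_ne_zero.2 (hmq k)
    have h5 := sub_ne_zero.2 (hms k)
    rw [hA', hA]
    simp only [Matrix.add_apply, Matrix.mul_apply, Fin.sum_univ_two, hU, hQ, hC, cauchyLike, of_apply,
      resolventVec, cons_val_zero, cons_val_one, cons_val', cons_val_fin_one]
    field_simp
    ring
  have hu : IsUnit (1 + A * B).det := isUnit_iff_ne_zero.2 hdet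
  have hfac : 1 + A' * B = (1 + U * (C * Q * S)) * (1 + A * B) := by
    have hSG : S * (1 + A * B) = B := by
      rw [hS, Matrix.mul_assoc, Matrix.nonsing_inv_mul _ hu, Matrix.mul_one]
    rw [Matrix.add_mul, Matrix.one_mul, Matrix.mul_assoc, Matrix.mul_assoc (C * Q), hSG, hAA,
      Matrix.add_mul, ← add_assoc, Matrix.mul_assoc]
  have hV : ∀ i j, (Q * S * U) i j =
      resolventVec a m (![q, s] i) ⬝ᵥ S *ᵥ resolventVec g b (![p, r] j) := fun i j => by
    rw [Matrix.mul_assoc]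
    rfl
  rw [hfac, det_mul, det_one_add_mul_comm, Matrix.mul_assoc, Matrix.mul_assoc,
    ← Matrix.mul_assoc Q, mul_comm, det_fin_two]
  generalize Q * S * U = V at hV
  simp only [Matrix.add_apply, Matrix.mul_apply, Fin.sum_univ_two, hV, hC, of_apply,
    cons_val_zero, cons_val_one, cons_val', cons_val_fin_one, one_apply_eq, twoPoint,
    one_apply_ne (zero_ne_one (α := Fin 2)), one_apply_ne (one_ne_zero (α := Fin 2))]
  congr 1
  field_simp
  ring

end CauchyLike

section TodaIdentity

variable {ι : Type*} [Fintype ι] [DecidableEq ι]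

omit [DecidableEq ι] in
theorem trace_vecMulVec_mul_mul (u v u' v' : ι → ℝ) (S : Matrix ι ι ℝ) :
    trace (vecMulVec u v * S * (vecMulVec u' v' * S)) = (v ⬝ᵥ S *ᵥ u') * (v' ⬝ᵥ S *ᵥ u) := by
  rw [← Matrix.mul_assoc, trace_mul_comm, Matrix.mul_assoc, mul_vecMulVec S,
    vecMulVec_mul_vecMulVec, mul_vecMulVec, trace_vecMulVec, dotProduct_smul,
    dotProduct_comm _ v', smul_eq_mul]

theorem soll_eq {ζ s : ℝ} (h : s ≠ ζ) (h' : s ≠ -ζ) :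
    soll ζ s = -2 * ζ * (1 / (s - ζ) + 1 / (s - -ζ)) := by
  have h1 := sub_ne_zero.2 h
  have h2 : s + ζ ≠ 0 := fun h => h' (eq_neg_of_add_eq_zero_left h)
  rw [soll, solh, sub_neg_eq_add]
  field_simp
  ring

/-- `p` is none of the poles or zeros `±lam`, `±mu` of the dressing factors. -/
def IsRegularPoint (lam mu p : ℝ) : Prop := p ≠ lam ∧ p ≠ -lam ∧ p ≠ mu ∧ p ≠ -mu

theorem trace_sub_trace_eq_twoPoint {lam mu : ℝ} (hlm : lam - mu ≠ 0) (hlm' : lam + mu ≠ 0)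
    {b m : ι → ℝ} (g a : ι → ℝ) (hbm : ∀ j k, b j ≠ m k)
    (hb : ∀ j, IsRegularPoint lam mu (b j)) (hm : ∀ k, IsRegularPoint lam mu (m k))
    {A P Q : Matrix ι ι ℝ} (hA : A = cauchyLike g b a m)
    (hP : ∀ j k, P j k = soll lam (m k) - soll lam (b j))
    (hQ : ∀ j k, Q j k = soll mu (m k) - soll mu (b j)) (S : Matrix ι ι ℝ) :
    trace ((A ⊙ (P ⊙ Q)) * S) - trace ((A ⊙ P) * S * ((A ⊙ Q) * S)) =
      4 * lam * mu *
        ((twoPoint g b a m S lam mu * twoPoint g b a m S mu lam +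
            twoPoint g b a m S (-lam) (-mu) * twoPoint g b a m S (-mu) (-lam) - 2) /
              (lam - mu) ^ 2 +
          (twoPoint g b a m S lam (-mu) * twoPoint g b a m S (-mu) lam +
            twoPoint g b a m S (-lam) mu * twoPoint g b a m S mu (-lam) - 2) /
              (lam + mu) ^ 2) := by
  set E : ℝ → ℝ → Matrix ι ι ℝ :=
    fun p q => vecMulVec (resolventVec g b p) (resolventVec a m q) with hE
  have hP' : A ⊙ P = (-2 * lam) • (E lam lam + E (-lam) (-lam)) := by
    ext j k
    obtain ⟨b1, b2, -, -⟩ := hb j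
    obtain ⟨m1, m2, -, -⟩ := hm k
    simp only [hadamard_apply, hP, hA, hE, Matrix.smul_apply, Matrix.add_apply, vecMulVec_apply,
      resolventVec, cauchyLike, of_apply, smul_eq_mul, soll_eq b1 b2, soll_eq m1 m2]
    have := sub_ne_zero.2 (hbm j k)
    have := sub_ne_zero.2 b1
    have := sub_ne_zero.2 b2
    have := sub_ne_zero.2 m1
    have := sub_ne_zero.2 m2
    field_simp
    ring
  have hQ' : A ⊙ Q = (-2 * mu) • (E mu mu + E (-mu) (-mu)) := by
    ext j k
    obtain ⟨-, -, b1, b2⟩ := hb j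
    obtain ⟨-, -, m1, m2⟩ := hm k
    simp only [hadamard_apply, hQ, hA, hE, Matrix.smul_apply, Matrix.add_apply, vecMulVec_apply,
      resolventVec, cauchyLike, of_apply, smul_eq_mul, soll_eq b1 b2, soll_eq m1 m2]
    have := sub_ne_zero.2 (hbm j k)
    have := sub_ne_zero.2 b1
    have := sub_ne_zero.2 b2
    have := sub_ne_zero.2 m1
    have := sub_ne_zero.2 m2
    field_simp
    ring
  have hPQ' : A ⊙ (P ⊙ Q) = (4 * lam * mu) •
      ((lam - mu)⁻¹ • (E mu lam - E lam mu + E (-lam) (-mu) - E (-mu) (-lam)) +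
        (lam + mu)⁻¹ • (E (-mu) lam - E lam (-mu) + E (-lam) mu - E mu (-lam))) := by
    have key : ∀ p q x y z : ℝ, x - y ≠ 0 → x - p ≠ 0 → x - q ≠ 0 → y - p ≠ 0 → y - q ≠ 0 →
        p - q ≠ 0 → z / (x - y) * ((1 / (y - p) - 1 / (x - p)) * (1 / (y - q) - 1 / (x - q))) =
          (p - q)⁻¹ * (z / ((x - q) * (y - p)) - z / ((x - p) * (y - q))) := by
      intro p q x y z h1 h2 h3 h4 h5 h6
      field_simp
      ring
    ext j k
    obtain ⟨b1, b2, b3, b4⟩ := hb j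
    obtain ⟨m1, m2, m3, m4⟩ := hm k
    simp only [hadamard_apply, hP, hQ, hA, hE, Matrix.smul_apply, Matrix.add_apply, Matrix.sub_apply,
      vecMulVec_apply, resolventVec, cauchyLike, of_apply, smul_eq_mul, soll_eq b1 b2,
      soll_eq m1 m2, soll_eq b3 b4, soll_eq m3 m4]
    rw [← sub_ne_zero] at b1 b2 b3 b4 m1 m2 m3 m4
    have h0 := sub_ne_zero.2 (hbm j k)
    have k1 := key lam mu _ _ (g j * a k) h0 b1 b3 m1 m3 hlm
    have k2 := key lam (-mu) _ _ (g j * a k) h0 b1 b4 m1 m4 (by rwa [sub_neg_eq_add])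
    have k3 := key (-lam) mu _ _ (g j * a k) h0 b2 b3 m2 m3
      (fun h => hlm' (by linear_combination -h))
    have k4 := key (-lam) (-mu) _ _ (g j * a k) h0 b2 b4 m2 m4
      (fun h => hlm (by linear_combination -h))
    rw [show -lam - mu = -(lam + mu) by ring, inv_neg] at k3
    rw [show -lam - -mu = -(lam - mu) by ring, inv_neg] at k4
    rw [show lam - -mu = lam + mu by ring] at k2
    simp only [div_mul_div_comm]
    linear_combination (4 * lam * mu) * (k1 + k2 + k3 + k4)
  rw [hP', hQ', hPQ']
  simp only [hE, Matrix.add_mul, Matrix.sub_mul, Matrix.mul_add, smul_mul_assoc, mul_smul_comm,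
    trace_add, trace_sub, trace_smul, trace_vecMulVec_mul, trace_vecMulVec_mul_mul, smul_eq_mul,
    twoPoint]
  field_simp
  ring

end TodaIdentity

section TodaBilinear

variable {ι : Type*} [Fintype ι] [DecidableEq ι]

theorem four_point_wedge_identity (lam mu : ℝ) (T : ℝ → ℝ → ℝ) {u₁ u₂ w₁ w₂ : ℝ → ℝ}
    (hT : ∀ p q, p ∈ ({lam, -lam, mu, -mu} : Set ℝ) → q ∈ ({lam, -lam, mu, -mu} : Set ℝ) →
      T p q = u₁ p * w₂ q - u₂ p * w₁ q)
    (hT₁ : ∀ p, T p p = 1) :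
    (T lam (-lam) * T (-mu) mu * (lam - mu) ^ 2 +
          4 * lam * mu * (T lam mu * T (-mu) (-lam))) *
        (T (-lam) lam * T mu (-mu) * (lam - mu) ^ 2 +
          4 * lam * mu * (T (-lam) (-mu) * T mu lam)) -
      (T lam (-lam) * T mu (-mu) * (lam + mu) ^ 2 -
          4 * lam * mu * (T lam (-mu) * T mu (-lam))) *
        (T (-lam) lam * T (-mu) mu * (lam + mu) ^ 2 -
          4 * lam * mu * (T (-lam) mu * T (-mu) lam)) =
      4 * lam * mu *
        ((lam + mu) ^ 2 * (T lam mu * T mu lam + T (-lam) (-mu) * T (-mu) (-lam) - 1) +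
          (lam - mu) ^ 2 * (T lam (-mu) * T (-mu) lam + T (-lam) mu * T mu (-lam) - 1)) := by
  have key : ∀ x y : ℝ,
      (T lam (-lam) * T (-mu) mu * x + (y - x) * (T lam mu * T (-mu) (-lam))) *
          (T (-lam) lam * T mu (-mu) * x + (y - x) * (T (-lam) (-mu) * T mu lam)) -
        (T lam (-lam) * T mu (-mu) * y - (y - x) * (T lam (-mu) * T mu (-lam))) *
          (T (-lam) lam * T (-mu) mu * y - (y - x) * (T (-lam) mu * T (-mu) lam)) =
        (y - x) *
          (y * (T lam mu * T mu lam * (T (-lam) (-lam) * T (-mu) (-mu)) +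
              T (-lam) (-mu) * T (-mu) (-lam) * (T lam lam * T mu mu) -
              T lam lam * T mu mu * (T (-lam) (-lam) * T (-mu) (-mu))) +
            x * (T lam (-mu) * T (-mu) lam * (T (-lam) (-lam) * T mu mu) +
              T (-lam) mu * T mu (-lam) * (T lam lam * T (-mu) (-mu)) -
              T lam lam * T mu mu * (T (-lam) (-lam) * T (-mu) (-mu)))) := by
    intro x y
    simp (disch := simp) only [hT]
    ring
  have h := key ((lam - mu) ^ 2) ((lam + mu) ^ 2)
  rw [show (lam + mu) ^ 2 - (lam - mu) ^ 2 = 4 * lam * mu by ring] at h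
  simpa only [hT₁, mul_one] using h

end TodaBilinear

section TodaEquation

variable {ι : Type*} [Fintype ι] [DecidableEq ι]

theorem solh_ne_zero {ζ s : ℝ} (h : s ≠ ζ) (h' : s ≠ -ζ) : solh ζ s ≠ 0 :=
  div_ne_zero (sub_ne_zero.2 h) fun h => h' (eq_neg_of_add_eq_zero_left h)

/-- The matrix of relative changes of `g j * a k` when `g` is divided and `a` multiplied
by the values of `ρ` at the nodes `b` and `m`. -/
def gaugeRatio (ρ : ℝ → ℝ) (b m : ι → ℝ) : Matrix ι ι ℝ := of fun j k => ρ (m k) / ρ (b j)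

theorem bilinear_of_det_ne_zero {lam mu : ℝ}
    (hlm : lam - mu ≠ 0) (hlm' : lam + mu ≠ 0)
    {b m : ι → ℝ} (g a f d : ι → ℝ) (hbm : ∀ j k, b j ≠ m k)
    (hb : ∀ j, IsRegularPoint lam mu (b j)) (hm : ∀ k, IsRegularPoint lam mu (m k))
    {A B P Q : Matrix ι ι ℝ} (hA : A = cauchyLike g b a m) (hB : B = cauchyLike f m d b)
    (hP : ∀ j k, P j k = soll lam (m k) - soll lam (b j))
    (hQ : ∀ j k, Q j k = soll mu (m k) - soll mu (b j))
    (hdet : (1 + A * B).det ≠ 0) :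
    8 * (lam * mu * (lam ^ 2 + mu ^ 2) / (lam ^ 2 - mu ^ 2) ^ 2) * (1 + A * B).det ^ 2 +
        ((1 + A * B).det * trace (adjugateDeriv (1 + A * B) ((A ⊙ P) * B) * ((A ⊙ Q) * B) +
            adjugate (1 + A * B) * ((A ⊙ (P ⊙ Q)) * B)) -
          trace (adjugate (1 + A * B) * ((A ⊙ P) * B)) *
            trace (adjugate (1 + A * B) * ((A ⊙ Q) * B))) =
      ((lam + mu) / (lam - mu)) ^ 2 *
          (1 + (A ⊙ gaugeRatio (fun s => (solh lam s)⁻¹ * solh mu s) b m) * B).det *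
          (1 + (A ⊙ gaugeRatio (fun s => solh lam s * (solh mu s)⁻¹) b m) * B).det -
        ((lam - mu) / (lam + mu)) ^ 2 *
          (1 + (A ⊙ gaugeRatio (fun s => (solh lam s)⁻¹ * (solh mu s)⁻¹) b m) * B).det *
          (1 + (A ⊙ gaugeRatio (fun s => solh lam s * solh mu s) b m) * B).det := by
  obtain ⟨S, hS⟩ : ∃ S, S = B * (1 + A * B)⁻¹ := ⟨_, rfl⟩
  have hS' := hS
  have hdet' := hdet
  rw [hA, hB] at hS' hdet'
  obtain ⟨u₁, u₂, w₁, w₂, hw⟩ := exists_twoPoint_eq_wedge g a f d hbm hdet' hS'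
  have hT₁ : ∀ p, twoPoint g b a m S p p = 1 := fun p => by simp [twoPoint]
  have hreg : ∀ {v : ι → ℝ}, (∀ j, IsRegularPoint lam mu (v j)) →
      ∀ p ∈ ({lam, -lam, mu, -mu} : Set ℝ), ∀ j, v j ≠ p := by
    rintro v hv p hp j rfl
    obtain ⟨h1, h2, h3, h4⟩ := hv j
    simp [h1, h2, h3, h4] at hp
  have hwedge := four_point_wedge_identity lam mu (twoPoint g b a m S)
    (fun p q hp hq => hw p q (hreg hb p hp) (hreg hm q hq)) hT₁
  have hbl := fun j => (hb j).1
  have hbl' := fun j => (hb j).2.1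
  have hbu := fun j => (hb j).2.2.1
  have hbu' := fun j => (hb j).2.2.2
  have hml := fun j => (hm j).1
  have hml' := fun j => (hm j).2.1
  have hmu₁ := fun j => (hm j).2.2.1
  have hmu' := fun j => (hm j).2.2.2
  have hlm₁ : lam ≠ mu := sub_ne_zero.1 hlm
  have hlm₂ : lam ≠ -mu := fun h => hlm' (by linear_combination h)
  have hrat : ∀ {p q r s : ℝ} {ρ : ℝ → ℝ},
      (∀ x, IsRegularPoint lam mu x → ρ x = (x - p) * (x - r) / ((x - q) * (x - s))) →
      ∀ j k, (A ⊙ gaugeRatio ρ b m) j k =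
        A j k * ((m k - p) * (m k - r) * ((b j - q) * (b j - s)) /
          ((b j - p) * (b j - r) * ((m k - q) * (m k - s)))) := by
    intro p q r s ρ hρ j k
    rw [hadamard_apply, gaugeRatio, of_apply, hρ _ (hb j), hρ _ (hm k), div_div_div_eq,
      mul_comm ((m k - q) * (m k - s))]
  have h1 := det_one_add_shift g a hbm hA hdet hS hbl' hbu hml hmu'
    (p := -lam) (r := mu) (q := lam) (s := -mu) (fun h => hlm₂ (by linear_combination -h))
    (fun h => hlm₂ h.symm) (hrat (ρ := fun s => (solh lam s)⁻¹ * solh mu s) fun x _ => by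
      simp only [solh, inv_div, div_mul_div_comm, sub_neg_eq_add])
  have h2 := det_one_add_shift g a hbm hA hdet hS hbl hbu' hml' hmu₁
    (p := lam) (r := -mu) (q := -lam) (s := mu) hlm₂
    (fun h => hlm₂ (by linear_combination h))
    (hrat (ρ := fun s => solh lam s * (solh mu s)⁻¹) fun x _ => by
      simp only [solh, inv_div, div_mul_div_comm, sub_neg_eq_add])
  have h3 := det_one_add_shift g a hbm hA hdet hS hbl' hbu' hml hmu₁
    (p := -lam) (r := -mu) (q := lam) (s := mu) (fun h => hlm₁ (by linear_combination -h))
    hlm₁.symm (hrat (ρ := fun s => (solh lam s)⁻¹ * (solh mu s)⁻¹) fun x _ => by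
      simp only [solh, inv_div, div_mul_div_comm, sub_neg_eq_add])
  have h4 := det_one_add_shift g a hbm hA hdet hS hbl hbu hml' hmu'
    (p := lam) (r := mu) (q := -lam) (s := -mu) hlm₁
    (fun h => hlm₁ (by linear_combination h))
    (hrat (ρ := fun s => solh lam s * solh mu s) fun x _ => by
      simp only [solh, div_mul_div_comm, sub_neg_eq_add])
  have htr₁ : trace ((1 + A * B)⁻¹ * ((A ⊙ (P ⊙ Q)) * B)) = trace ((A ⊙ (P ⊙ Q)) * S) := by
    rw [trace_mul_comm, Matrix.mul_assoc, hS]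
  have htr₂ : trace ((1 + A * B)⁻¹ * ((A ⊙ P) * B) * ((1 + A * B)⁻¹ * ((A ⊙ Q) * B))) =
      trace ((A ⊙ P) * S * ((A ⊙ Q) * S)) := by
    rw [Matrix.mul_assoc, trace_mul_comm, hS]
    simp only [Matrix.mul_assoc]
  rw [adjugateDeriv_bilinear_eq hdet, htr₁, htr₂,
    trace_sub_trace_eq_twoPoint hlm hlm' g a hbm hb hm hA hP hQ S, h1, h2, h3, h4]
  rw [show lam ^ 2 - mu ^ 2 = (lam - mu) * (lam + mu) by ring]
  rw [show -lam - mu = -(lam + mu) by ring, show -lam - -mu = -(lam - mu) by ring,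
    show lam - -mu = lam + mu by ring, show -mu - lam = -(lam + mu) by ring,
    show mu - lam = -(lam - mu) by ring, show -mu - -lam = lam - mu by ring,
    show mu - -lam = lam + mu by ring, show -lam - lam = -(2 * lam) by ring,
    show mu - -mu = 2 * mu by ring, show lam - -lam = 2 * lam by ring,
    show -mu - mu = -(2 * mu) by ring]
  generalize (1 + A * B).det = D
  generalize twoPoint g b a m S = T at *
  have hden : ((lam - mu) * (lam + mu)) ^ 2 ≠ 0 := pow_ne_zero 2 (mul_ne_zero hlm hlm')
  have hL : 8 * (lam * mu * (lam ^ 2 + mu ^ 2) / ((lam - mu) * (lam + mu)) ^ 2) * D ^ 2 +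
      D ^ 2 * (4 * lam * mu *
        ((T lam mu * T mu lam + T (-lam) (-mu) * T (-mu) (-lam) - 2) / (lam - mu) ^ 2 +
          (T lam (-mu) * T (-mu) lam + T (-lam) mu * T mu (-lam) - 2) / (lam + mu) ^ 2)) =
      D ^ 2 / ((lam - mu) * (lam + mu)) ^ 2 * (4 * lam * mu *
        ((lam + mu) ^ 2 * (T lam mu * T mu lam + T (-lam) (-mu) * T (-mu) (-lam) - 1) +
          (lam - mu) ^ 2 * (T lam (-mu) * T (-mu) lam + T (-lam) mu * T mu (-lam) - 1))) := by
    field_simp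
    ring
  rw [hL, ← hwedge]
  field_simp
  ring

theorem bilinear_of_cauchyLike {lam mu : ℝ}
    (hlm : lam - mu ≠ 0) (hlm' : lam + mu ≠ 0)
    {b m : ι → ℝ} (g a f d : ι → ℝ) (hbm : ∀ j k, b j ≠ m k)
    (hb : ∀ j, IsRegularPoint lam mu (b j)) (hm : ∀ k, IsRegularPoint lam mu (m k))
    {A B P Q : Matrix ι ι ℝ} (hA : A = cauchyLike g b a m) (hB : B = cauchyLike f m d b)
    (hP : ∀ j k, P j k = soll lam (m k) - soll lam (b j))
    (hQ : ∀ j k, Q j k = soll mu (m k) - soll mu (b j)) :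
    8 * (lam * mu * (lam ^ 2 + mu ^ 2) / (lam ^ 2 - mu ^ 2) ^ 2) * (1 + A * B).det ^ 2 +
        ((1 + A * B).det * trace (adjugateDeriv (1 + A * B) ((A ⊙ P) * B) * ((A ⊙ Q) * B) +
            adjugate (1 + A * B) * ((A ⊙ (P ⊙ Q)) * B)) -
          trace (adjugate (1 + A * B) * ((A ⊙ P) * B)) *
            trace (adjugate (1 + A * B) * ((A ⊙ Q) * B))) =
      ((lam + mu) / (lam - mu)) ^ 2 *
          (1 + (A ⊙ gaugeRatio (fun s => (solh lam s)⁻¹ * solh mu s) b m) * B).det *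
          (1 + (A ⊙ gaugeRatio (fun s => solh lam s * (solh mu s)⁻¹) b m) * B).det -
        ((lam - mu) / (lam + mu)) ^ 2 *
          (1 + (A ⊙ gaugeRatio (fun s => (solh lam s)⁻¹ * (solh mu s)⁻¹) b m) * B).det *
          (1 + (A ⊙ gaugeRatio (fun s => solh lam s * solh mu s) b m) * B).det := by
  have hscale : ∀ ε : ℝ, ε • A = cauchyLike g b (ε • a) m := fun ε => by
    ext j k
    simp only [hA, cauchyLike, Matrix.smul_apply, of_apply, Pi.smul_apply, smul_eq_mul]
    ring
  have hH : ∀ X : Matrix ι ι ℝ, Continuous fun ε : ℝ => ((ε • A) ⊙ X) * B := fun X => by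
    simp only [smul_hadamard, smul_mul_assoc]
    exact continuous_id.smul continuous_const
  have hG : Continuous fun ε : ℝ => 1 + (ε • A) * B := by
    simp only [smul_mul_assoc]
    exact continuous_const.add (continuous_id.smul continuous_const)
  have hdet : ∀ X : Matrix ι ι ℝ, Continuous fun ε : ℝ => (1 + ((ε • A) ⊙ X) * B).det :=
    fun X => (continuous_const.add (hH X)).matrix_det
  have htr : ∀ X : Matrix ι ι ℝ,
      Continuous fun ε : ℝ => trace (adjugate (1 + (ε • A) * B) * (((ε • A) ⊙ X) * B)) :=
    fun X => (hG.matrix_adjugate.matrix_mul (hH X)).matrix_trace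
  have key := Continuous.ext_on (dense_det_one_add_smul_ne_zero (A * B))
    ((continuous_const.mul (hG.matrix_det.pow 2)).add
      ((hG.matrix_det.mul
        (((continuous_adjugateDeriv hG (hH P)).matrix_mul (hH Q)).add
          (hG.matrix_adjugate.matrix_mul (hH (P ⊙ Q)))).matrix_trace).sub
        ((htr P).mul (htr Q))))
    (((continuous_const.mul (hdet _)).mul (hdet _)).sub
      ((continuous_const.mul (hdet _)).mul (hdet _)))
    (fun ε hε => bilinear_of_det_ne_zero hlm hlm' g (ε • a) f d hbm hb hm (hscale ε) hB hP hQ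
      (by rwa [smul_mul_assoc]))
  simpa only [Pi.add_apply, Pi.sub_apply, Pi.mul_apply, Pi.pow_apply, one_smul] using
    congrFun key 1

/-- The bilinear expression `W W_xy - W_x W_y` for `W = exp (κ x y + c) * det (1 + K B)`, where
the entries of `K` are exponentials of linear functions of `x` and `y`. -/
theorem mul_deriv_deriv_sub_deriv_mul_deriv {K : ℝ → ℝ → Matrix ι ι ℝ} {K₀ P Q : Matrix ι ι ℝ}
    (hK : ∀ x y j k, K x y j k = K₀ j k * exp (x * P j k + y * Q j k)) (B : Matrix ι ι ℝ)
    {W : ℝ → ℝ → ℝ} {κ c : ℝ}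
    (hW : ∀ x y, W x y = exp (κ * (x * y) + c) * (1 + K x y * B).det) (x y : ℝ) :
    W x y * deriv (fun x' => deriv (fun y' => W x' y') y) x -
        deriv (fun x' => W x' y) x * deriv (fun y' => W x y') y =
      exp (κ * (x * y) + c) ^ 2 * (κ * (1 + K x y * B).det ^ 2 +
        ((1 + K x y * B).det *
          trace (adjugateDeriv (1 + K x y * B) ((K x y ⊙ P) * B) * ((K x y ⊙ Q) * B) +
            adjugate (1 + K x y * B) * ((K x y ⊙ (P ⊙ Q)) * B)) -
          trace (adjugate (1 + K x y * B) * ((K x y ⊙ P) * B)) *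
            trace (adjugate (1 + K x y * B) * ((K x y ⊙ Q) * B)))) := by
  have hKx : ∀ x y j k, HasDerivAt (fun s => K s y j k) ((K x y ⊙ P) j k) x := fun x y j k => by
    simp only [hK, hadamard_apply]
    convert! ((((hasDerivAt_id x).mul_const (P j k)).add_const (y * Q j k)).exp).const_mul
      (K₀ j k) using 1
    simp only [id_eq]
    ring
  have hKy : ∀ x y j k, HasDerivAt (fun s => K x s j k) ((K x y ⊙ Q) j k) y := fun x y j k => by
    simp only [hK, hadamard_apply]
    convert! ((((hasDerivAt_id y).mul_const (Q j k)).const_add (x * P j k)).exp).const_mul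
      (K₀ j k) using 1
    simp only [id_eq]
    ring
  have hmulB : ∀ {M : ℝ → Matrix ι ι ℝ} {M' : Matrix ι ι ℝ} {t : ℝ},
      (∀ j k, HasDerivAt (fun s => M s j k) (M' j k) t) →
      ∀ j k, HasDerivAt (fun s => (M s * B) j k) ((M' * B) j k) t := fun {M M' t} hM j k => by
    simpa using hasDerivAt_mul_apply hM (P := fun _ => B) (P' := 0)
      (fun i j => hasDerivAt_const t (B i j)) j k
  have hGx : ∀ x y j k,
      HasDerivAt (fun s => (1 + K s y * B) j k) (((K x y ⊙ P) * B) j k) x :=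
    fun x y j k => (hmulB (hKx x y) j k).const_add _
  have hGy : ∀ x y j k,
      HasDerivAt (fun s => (1 + K x s * B) j k) (((K x y ⊙ Q) * B) j k) y :=
    fun x y j k => (hmulB (hKy x y) j k).const_add _
  have hKQx : ∀ x y j k,
      HasDerivAt (fun s => (K s y ⊙ Q) j k) ((K x y ⊙ (P ⊙ Q)) j k) x := fun x y j k => by
    simpa only [hadamard_apply, mul_assoc] using (hKx x y j k).mul_const (Q j k)
  have hEx : ∀ x y, HasDerivAt (fun s => exp (κ * (s * y) + c))
      (exp (κ * (x * y) + c) * (κ * y)) x := fun x y => by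
    simpa using ((((hasDerivAt_id x).mul_const y).const_mul κ).add_const c).exp
  have hEy : ∀ x y, HasDerivAt (fun s => exp (κ * (x * s) + c))
      (exp (κ * (x * y) + c) * (κ * x)) y := fun x y => by
    simpa using ((((hasDerivAt_id y).const_mul x).const_mul κ).add_const c).exp
  have hWx := ((hEx x y).mul (hasDerivAt_det (hGx x y))).deriv
  have hWy := fun x => ((hEy x y).mul (hasDerivAt_det (hGy x y))).deriv
  have htr : HasDerivAt
      (fun s => trace (adjugate (1 + K s y * B) * ((K s y ⊙ Q) * B)))
      (trace (adjugateDeriv (1 + K x y * B) ((K x y ⊙ P) * B) * ((K x y ⊙ Q) * B) +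
        adjugate (1 + K x y * B) * ((K x y ⊙ (P ⊙ Q)) * B))) x :=
    HasDerivAt.fun_sum fun i _ =>
      hasDerivAt_mul_apply (hasDerivAt_adjugate (hGx x y)) (hmulB (hKQx x y)) i i
  have hWxy := ((((hEx x y).mul ((hasDerivAt_id x).const_mul κ)).mul
    (hasDerivAt_det (hGx x y))).add ((hEx x y).mul htr)).deriv
  have e1 : (fun x' => deriv (fun y' => W x' y') y) =
      (((fun s => exp (κ * (s * y) + c)) * fun s => κ * id s) * fun s => (1 + K s y * B).det) +
        (fun s => exp (κ * (s * y) + c)) *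
          fun s => trace (adjugate (1 + K s y * B) * ((K s y ⊙ Q) * B)) := by
    funext s
    simp only [hW]
    exact hWy s
  have e2 : (fun x' => W x' y) =
      (fun s => exp (κ * (s * y) + c)) * fun s => (1 + K s y * B).det := by
    funext s
    exact hW s y
  have e3 : (fun y' => W x y') =
      (fun s => exp (κ * (x * s) + c)) * fun s => (1 + K x s * B).det := by
    funext s
    exact hW x s
  rw [e1, e2, e3, hWxy, hWx, hWy, hW]
  simp only [id_eq, Pi.mul_apply]
  ring

end TodaEquation

section TodaSoliton

/-- The plane wave factor attached to a spectral point `s`. -/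
def planeWave (lam mu x y : ℝ) (n₁ n₂ : ℤ) (s : ℝ) : ℝ :=
  exp (x * soll lam s + y * soll mu s) * solh lam s ^ (n₁ + n₂) * solh mu s ^ (n₂ - n₁)

theorem solhb_eq_inv (ζ s : ℝ) : solhb ζ s = (solh ζ s)⁻¹ := by
  rw [solhb, solh, inv_div]

theorem sollb_eq_neg (ζ s : ℝ) : sollb ζ s = -soll ζ s := by
  rw [sollb, soll, solhb_eq_inv, one_div, one_div, inv_inv, neg_sub]

theorem planeWave_eq_mul_exp (lam mu x y : ℝ) (n₁ n₂ : ℤ) (s : ℝ) :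
    planeWave lam mu x y n₁ n₂ s =
      planeWave lam mu 0 0 n₁ n₂ s * exp (x * soll lam s + y * soll mu s) := by
  simp only [planeWave, zero_mul, add_zero, exp_zero, one_mul]
  ring

theorem planeWave_shift {lam mu s : ℝ} (hs : IsRegularPoint lam mu s) (x y : ℝ)
    (n₁ n₂ i j : ℤ) :
    planeWave lam mu x y (n₁ + i) (n₂ + j) s =
      planeWave lam mu x y n₁ n₂ s * (solh lam s ^ (i + j) * solh mu s ^ (j - i)) := by
  have h1 := solh_ne_zero hs.1 hs.2.1
  have h2 := solh_ne_zero hs.2.2.1 hs.2.2.2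
  rw [planeWave, planeWave, show n₁ + i + (n₂ + j) = n₁ + n₂ + (i + j) by ring,
    show n₂ + j - (n₁ + i) = n₂ - n₁ + (j - i) by ring, zpow_add₀ h1, zpow_add₀ h2]
  ring

/-- A Cauchy-like matrix, diagonally conjugate to `solA`, which absorbs the plane waves of
both `solA` and `solAb`. -/
def gaugedSolA (N : ℕ) (lam mu : ℝ) (m mb c : Fin N → ℝ) (x y : ℝ) (n₁ n₂ : ℤ) :
    Matrix (Fin N) (Fin N) ℝ :=
  cauchyLike (fun j => (planeWave lam mu x y n₁ n₂ (mb j))⁻¹) mb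
    (fun k => c k * planeWave lam mu x y n₁ n₂ (m k)) m

theorem det_one_add_solA_mul_solAb {N : ℕ} (lam mu : ℝ) (m mb c cb : Fin N → ℝ) (x y : ℝ)
    (n₁ n₂ : ℤ) :
    (1 + solA N lam mu m mb c x y n₁ n₂ * solAb N lam mu m mb cb x y n₁ n₂).det =
      (1 + gaugedSolA N lam mu m mb c x y n₁ n₂ * cauchyLike 1 m cb mb).det := by
  have h1 : gaugedSolA N lam mu m mb c x y n₁ n₂ =
      diagonal (fun j => (planeWave lam mu x y n₁ n₂ (mb j))⁻¹) *
        solA N lam mu m mb c x y n₁ n₂ := by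
    ext j k
    simp only [gaugedSolA, cauchyLike, solA, planeWave, diagonal_mul, of_apply]
    ring
  have h2 : solAb N lam mu m mb cb x y n₁ n₂ = cauchyLike 1 m cb mb *
      diagonal (fun j => (planeWave lam mu x y n₁ n₂ (mb j))⁻¹) := by
    ext j k
    simp only [cauchyLike, solAb, planeWave, mul_diagonal, of_apply, solhb_eq_inv, sollb_eq_neg,
      mul_neg, ← neg_add, exp_neg, _root_.inv_zpow, mul_inv, Pi.one_apply, one_mul]
    ring
  rw [h1, h2, ← Matrix.mul_assoc, det_one_add_mul_comm, Matrix.mul_assoc]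

theorem gaugedSolA_eq_mul_exp {N : ℕ} (lam mu : ℝ) (m mb c : Fin N → ℝ) (x y : ℝ)
    (n₁ n₂ : ℤ) (j k : Fin N) :
    gaugedSolA N lam mu m mb c x y n₁ n₂ j k = gaugedSolA N lam mu m mb c 0 0 n₁ n₂ j k *
      exp (x * (soll lam (m k) - soll lam (mb j)) + y * (soll mu (m k) - soll mu (mb j))) := by
  have h : x * (soll lam (m k) - soll lam (mb j)) + y * (soll mu (m k) - soll mu (mb j)) =
      (x * soll lam (m k) + y * soll mu (m k)) +
        -(x * soll lam (mb j) + y * soll mu (mb j)) := by ring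
  simp only [gaugedSolA, cauchyLike, of_apply]
  rw [planeWave_eq_mul_exp lam mu x y n₁ n₂ (mb j), planeWave_eq_mul_exp lam mu x y n₁ n₂ (m k),
    h, exp_add _ (-_), exp_neg, mul_inv]
  ring

theorem gaugedSolA_shift {N : ℕ} {lam mu : ℝ} {m mb : Fin N → ℝ} (c : Fin N → ℝ)
    (hm : ∀ k, IsRegularPoint lam mu (m k)) (hmb : ∀ k, IsRegularPoint lam mu (mb k))
    (x y : ℝ) (n₁ n₂ i j : ℤ) :
    gaugedSolA N lam mu m mb c x y (n₁ + i) (n₂ + j) =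
      gaugedSolA N lam mu m mb c x y n₁ n₂ ⊙
        gaugeRatio (fun s => solh lam s ^ (i + j) * solh mu s ^ (j - i)) mb m := by
  ext p q
  simp only [gaugedSolA, cauchyLike, gaugeRatio, hadamard_apply, of_apply,
    planeWave_shift (hm q), planeWave_shift (hmb p), mul_inv, div_eq_mul_inv]
  ring

theorem solPhi_eq (lam mu x y : ℝ) (n₁ n₂ : ℤ) :
    solPhi lam mu x y n₁ n₂ =
      8 * (lam * mu * (lam ^ 2 + mu ^ 2) / (lam ^ 2 - mu ^ 2) ^ 2) * (x * y) +
        ((n₁ : ℝ) ^ 2 - (n₂ : ℝ) ^ 2) * log |(lam + mu) / (lam - mu)| := by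
  rw [solPhi]
  ring

theorem exp_two_mul_log_abs {r : ℝ} (hr : r ≠ 0) : exp (2 * log |r|) = r ^ 2 := by
  rw [two_mul, exp_add, exp_log (abs_pos.2 hr), ← sq, sq_abs]

theorem exp_solPhi_shift_fst {lam mu : ℝ} (hlm : lam - mu ≠ 0) (hlm' : lam + mu ≠ 0)
    (x y : ℝ) (n₁ n₂ : ℤ) :
    exp (solPhi lam mu x y (n₁ - 1) n₂) * exp (solPhi lam mu x y (n₁ + 1) n₂) =
      exp (solPhi lam mu x y n₁ n₂) ^ 2 * ((lam + mu) / (lam - mu)) ^ 2 := by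
  rw [← exp_two_mul_log_abs (div_ne_zero hlm' hlm), ← exp_nat_mul, ← exp_add, ← exp_add]
  congr 1
  simp only [solPhi]
  push_cast
  ring

theorem exp_solPhi_shift_snd {lam mu : ℝ} (hlm : lam - mu ≠ 0) (hlm' : lam + mu ≠ 0)
    (x y : ℝ) (n₁ n₂ : ℤ) :
    exp (solPhi lam mu x y n₁ (n₂ - 1)) * exp (solPhi lam mu x y n₁ (n₂ + 1)) =
      exp (solPhi lam mu x y n₁ n₂) ^ 2 * ((lam - mu) / (lam + mu)) ^ 2 := by
  rw [← inv_div (lam + mu), inv_pow, ← exp_two_mul_log_abs (div_ne_zero hlm' hlm), ← exp_neg,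
    ← exp_nat_mul, ← exp_add, ← exp_add]
  congr 1
  simp only [solPhi]
  push_cast
  ring

end TodaSoliton

theorem toda22_bilinear_soliton_solution
    (N : ℕ) (hN : 1 ≤ N) (lam mu : ℝ)
    (hlm : lam * mu * (lam - mu) * (lam + mu) ≠ 0)
    (m mb c cb : Fin N → ℝ)
    (hmmb : ∀ j k, mb j ≠ m k) (hmbm : ∀ j k, m j ≠ mb k)
    (hm : ∀ k, m k ≠ lam ∧ m k ≠ -lam ∧ m k ≠ mu ∧ m k ≠ -mu)
    (hmb : ∀ k, mb k ≠ lam ∧ mb k ≠ -lam ∧ mb k ≠ mu ∧ mb k ≠ -mu)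
    (ω : ℝ → ℝ → ℤ → ℤ → ℝ)
    (hω : ∀ (x y : ℝ) (n₁ n₂ : ℤ),
      ω x y n₁ n₂ = Real.exp (solPhi lam mu x y n₁ n₂) *
        ((1 : Matrix (Fin N) (Fin N) ℝ) +
          solA N lam mu m mb c x y n₁ n₂ * solAb N lam mu m mb cb x y n₁ n₂).det) :
    ∀ (x y : ℝ) (n₁ n₂ : ℤ),
      ω x y n₁ n₂ * deriv (fun x' => deriv (fun y' => ω x' y' n₁ n₂) y) x -
        deriv (fun x' => ω x' y n₁ n₂) x * deriv (fun y' => ω x y' n₁ n₂) y =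
      ω x y (n₁ - 1) n₂ * ω x y (n₁ + 1) n₂ -
        ω x y n₁ (n₂ - 1) * ω x y n₁ (n₂ + 1) := by
  intro x y n₁ n₂
  have hlm₁ : lam - mu ≠ 0 := right_ne_zero_of_mul (left_ne_zero_of_mul hlm)
  have hlm₂ : lam + mu ≠ 0 := right_ne_zero_of_mul hlm
  have hW : ∀ x y n₁ n₂, ω x y n₁ n₂ = exp (solPhi lam mu x y n₁ n₂) *
      (1 + gaugedSolA N lam mu m mb c x y n₁ n₂ * cauchyLike 1 m cb mb).det :=
    fun x y n₁ n₂ => by rw [hω, det_one_add_solA_mul_solAb]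
  have hderiv := mul_deriv_deriv_sub_deriv_mul_deriv
    (K := fun x y => gaugedSolA N lam mu m mb c x y n₁ n₂)
    (P := of fun j k => soll lam (m k) - soll lam (mb j))
    (Q := of fun j k => soll mu (m k) - soll mu (mb j))
    (fun x y j k => gaugedSolA_eq_mul_exp lam mu m mb c x y n₁ n₂ j k) (cauchyLike 1 m cb mb)
    (W := fun x y => ω x y n₁ n₂) (fun x y => by rw [hW, solPhi_eq]) x y
  have hbil := bilinear_of_cauchyLike hlm₁ hlm₂ _ _ 1 cb hmmb hmb hm
    (A := gaugedSolA N lam mu m mb c x y n₁ n₂)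
    (P := of fun j k => soll lam (m k) - soll lam (mb j))
    (Q := of fun j k => soll mu (m k) - soll mu (mb j)) rfl rfl
    (fun _ _ => rfl) (fun _ _ => rfl)
  have hshift := gaugedSolA_shift c hm hmb x y n₁ n₂
  have s1 := hshift (-1) 0
  have s2 := hshift 1 0
  have s3 := hshift 0 (-1)
  have s4 := hshift 0 1
  simp only [add_zero, zero_add, sub_zero, zero_sub, neg_neg, _root_.zpow_neg, zpow_one,
    ← sub_eq_add_neg] at s1 s2 s3 s4
  rw [← s1, ← s2, ← s3, ← s4] at hbil
  have e1 := exp_solPhi_shift_fst hlm₁ hlm₂ x y n₁ n₂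
  have e2 := exp_solPhi_shift_snd hlm₁ hlm₂ x y n₁ n₂
  rw [hderiv, hbil, ← solPhi_eq, hW x y (n₁ - 1), hW x y (n₁ + 1), hW x y n₁ (n₂ - 1),
    hW x y n₁ (n₂ + 1), mul_mul_mul_comm, mul_mul_mul_comm (exp _) _ (exp _), e1, e2]
  ring

end
end

section
/- Let α,β,γ,δ be pairwise distinct nonzero reals with all pairwise sums nonzero, such that m_k ∉ {±α,±β,±γ,±δ} and m̄_k ∉ {±α,±β,±γ,±δ} for all k. Assume 1 + A·Ā is invertible and τ[{δ}] ≠ 0. Then the tau-functions satisfy the second equation of the discrete BKP hierarchy: τ[∅]·τ[{α,β,γ,δ}] = Γ_{{α,δ},{β,γ}}·τ[{α,δ}]·τ[{β,γ}] + Γ_{{β,δ},{α,γ}}·τ[{β,δ}]·τ[{α,γ}] + Γ_{{γ,δ},{α,β}}·τ[{γ,δ}]·τ[{α,β}]. -/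
open Matrix

noncomputable section

/-- `H_ζ = (M - ζ)(M + ζ)⁻¹` for `M = diag(m)`. -/
def Hmat {N : ℕ} (m : Fin N → ℝ) (ζ : ℝ) : Matrix (Fin N) (Fin N) ℝ :=
  (Matrix.diagonal m - ζ • 1) * (Matrix.diagonal m + ζ • 1)⁻¹

/-- `H̄_ζ = (M̄ + ζ)(M̄ - ζ)⁻¹` for `M̄ = diag(m̄)`. -/
def Hbmat {N : ℕ} (mb : Fin N → ℝ) (ζ : ℝ) : Matrix (Fin N) (Fin N) ℝ :=
  (Matrix.diagonal mb + ζ • 1) * (Matrix.diagonal mb - ζ • 1)⁻¹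

/-- `τ[S] = det(1 + A·(∏_{ζ∈S} H_ζ)·Ā·(∏_{ζ∈S} H̄_ζ))`, the set `S` given as a list. -/
def tauL {N : ℕ} (m mb : Fin N → ℝ) (A Ab : Matrix (Fin N) (Fin N) ℝ)
    (S : List ℝ) : ℝ :=
  ((1 : Matrix (Fin N) (Fin N) ℝ) +
    A * (S.map (Hmat m)).prod * Ab * (S.map (Hbmat mb)).prod).det

/-- The residue at `t = -a`, up to sign, of `∏ (t - z) / (t + z)` over `z ∈ {a, b, c, d}`. -/
def cauchyWeight (a b c d : ℝ) : ℝ :=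
  2 * a * ((a + b) / (a - b)) * ((a + c) / (a - c)) * ((a + d) / (a - d))

theorem cauchyWeight_swap_left (a b c d : ℝ) : cauchyWeight a b c d = cauchyWeight a c b d := by
  unfold cauchyWeight
  ring

theorem cauchyWeight_swap_right (a b c d : ℝ) : cauchyWeight a b c d = cauchyWeight a b d c := by
  unfold cauchyWeight
  ring

theorem cauchyWeight_partial_fractions (a b c d t : ℝ)
    (hab : a - b ≠ 0) (hac : a - c ≠ 0) (had : a - d ≠ 0)
    (hbc : b - c ≠ 0) (hbd : b - d ≠ 0) (hcd : c - d ≠ 0)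
    (h1 : t + a ≠ 0) (h2 : t + b ≠ 0) (h3 : t + c ≠ 0) (h4 : t + d ≠ 0) :
    (t - a) / (t + a) * ((t - b) / (t + b)) * ((t - c) / (t + c)) * ((t - d) / (t + d)) =
      1 - cauchyWeight a b c d / (t + a) - cauchyWeight b a c d / (t + b) -
        cauchyWeight c a b d / (t + c) - cauchyWeight d a b c / (t + d) := by
  unfold cauchyWeight
  rw [← neg_sub a b, ← neg_sub a c, ← neg_sub a d, ← neg_sub b c, ← neg_sub b d, ← neg_sub c d]
  simp only [div_neg]
  field_simp
  ring

theorem cauchyWeight_sq_sum (a b c d : ℝ)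
    (hab : a - b ≠ 0) (hac : a - c ≠ 0) (had : a - d ≠ 0)
    (hbc : b - c ≠ 0) (hbd : b - d ≠ 0) (hcd : c - d ≠ 0)
    (h1 : a ≠ 0) (h2 : a + b ≠ 0) (h3 : a + c ≠ 0) (h4 : a + d ≠ 0) :
    cauchyWeight a b c d * (cauchyWeight a b c d / (a + a) ^ 2 +
      cauchyWeight b a c d / (a + b) ^ 2 + cauchyWeight c a b d / (a + c) ^ 2 +
      cauchyWeight d a b c / (a + d) ^ 2) = 1 := by
  unfold cauchyWeight
  rw [← neg_sub a b, ← neg_sub a c, ← neg_sub a d, ← neg_sub b c, ← neg_sub b d, ← neg_sub c d]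
  simp only [div_neg, ← two_mul]
  field_simp
  ring

theorem det_one_add_mul_det_cauchy {N : ℕ} {ι : Type*} [Fintype ι] [DecidableEq ι]
    (m mb αv av : Fin N → ℝ)
    (A Ab : Matrix (Fin N) (Fin N) ℝ)
    (hA : Matrix.diagonal mb * A - A * Matrix.diagonal m = Matrix.vecMulVec αv av)
    (hG : IsUnit (1 + A * Ab)) (z r : ι → ℝ)
    (hz : ∀ i j, z i + z j ≠ 0)
    (hm : ∀ k i, m k + z i ≠ 0) (hmb : ∀ k i, mb k - z i ≠ 0)
    (h1 : ∀ j, ∑ i, r i / (z j + z i) = 1)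
    (h2 : ∀ j, r j * ∑ i, r i / (z j + z i) ^ 2 = 1)
    (hinj : Function.Injective z) :
    (1 + A * Matrix.diagonal (fun k => 1 - ∑ i, r i / (m k + z i)) * Ab *
        Matrix.diagonal (fun k => 1 + ∑ i, r i / (mb k - z i))).det *
      (Matrix.of fun i j => 1 / (z i + z j)).det =
    (1 + A * Ab).det * (Matrix.of fun i j => 1 / (z i + z j) -
      (fun k => av k / (m k + z i)) ⬝ᵥ (Ab * (1 + A * Ab)⁻¹) *ᵥ (fun k => αv k / (mb k - z j))).det := by
  set C : Matrix ι ι ℝ := Matrix.of fun i j => 1 / (z i + z j) with hC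
  set U : Matrix (Fin N) ι ℝ := Matrix.of fun k j => αv k / (mb k - z j) with hU
  set V : Matrix ι (Fin N) ℝ := Matrix.of fun i k => av k / (m k + z i) with hV
  set D : Matrix ι ι ℝ := Matrix.diagonal r with hD
  set F := Matrix.diagonal (fun k => 1 - ∑ i, r i / (m k + z i)) with hF
  set E := Matrix.diagonal (fun k => 1 + ∑ i, r i / (mb k - z i)) with hE
  set G := (1 + A * Ab)⁻¹ with hGdef
  have hGu : (1 + A * Ab) * G = 1 := Matrix.mul_nonsing_inv _ ((Matrix.isUnit_iff_isUnit_det _).1 hG)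
  have hCD : C * (D * C * D) = 1 := by
    ext i j
    have : (C * (D * C * D)) i j = r j * ∑ k, r k / ((z i + z k) * (z j + z k)) := by
      rw [Matrix.mul_apply, Finset.mul_sum]
      refine Finset.sum_congr rfl fun k _ => ?_
      rw [hD, Matrix.mul_diagonal, Matrix.diagonal_mul]
      simp only [hC, Matrix.of_apply]
      have := hz i k
      have := hz j k
      rw [add_comm (z k) (z j)]
      field_simp
    rw [this]
    by_cases hij : i = j
    · subst hij
      simpa [pow_two] using h2 i
    · have hne : z j - z i ≠ 0 := sub_ne_zero.2 fun h => hij (hinj h.symm)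
      have : ∑ k, r k / ((z i + z k) * (z j + z k)) =
          (∑ k, r k / (z i + z k) - ∑ k, r k / (z j + z k)) / (z j - z i) := by
        rw [← Finset.sum_sub_distrib, Finset.sum_div]
        refine Finset.sum_congr rfl fun k _ => ?_
        have := hz i k
        have := hz j k
        field_simp
        ring
      rw [this, h1, h1, Matrix.one_apply_ne hij]
      simp
  have hEAF : E * A * F = A - U * (D * C * D) * V := by
    ext k l
    have hkl : (mb k - m l) * A k l = αv k * av l := by
      have := congrFun (congrFun hA k) l
      simp only [Matrix.sub_apply, Matrix.diagonal_mul, Matrix.mul_diagonal,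
        Matrix.vecMulVec_apply] at this
      linarith
    have hs : (U * (D * C * D) * V) k l =
        αv k * av l * ∑ i, ∑ j, r i * r j / ((z i + z j) * (mb k - z i) * (m l + z j)) := by
      rw [Matrix.mul_apply, Finset.sum_comm, Finset.mul_sum]
      refine Finset.sum_congr rfl fun j _ => ?_
      rw [Matrix.mul_apply, Finset.sum_mul, Finset.mul_sum]
      refine Finset.sum_congr rfl fun i _ => ?_
      rw [hD, Matrix.mul_diagonal, Matrix.diagonal_mul]
      simp only [hC, hU, hV, Matrix.of_apply]
      have := hz i j
      have := hm l j
      have := hmb k i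
      field_simp
    have hsum : (mb k - m l) *
        ∑ i, ∑ j, r i * r j / ((z i + z j) * (mb k - z i) * (m l + z j)) =
        ∑ j, r j / (m l + z j) - ∑ i, r i / (mb k - z i) +
        (∑ i, r i / (mb k - z i)) * ∑ j, r j / (m l + z j) := by
      have e1 : ∑ j, r j / (m l + z j) = ∑ i, ∑ j, (r i / (z j + z i)) * (r j / (m l + z j)) := by
        rw [Finset.sum_comm]
        refine Finset.sum_congr rfl fun j _ => ?_
        rw [← Finset.sum_mul, h1, one_mul]
      have e2 : ∑ i, r i / (mb k - z i) =
          ∑ i, ∑ j, (r j / (z i + z j)) * (r i / (mb k - z i)) := by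
        refine Finset.sum_congr rfl fun j _ => ?_
        rw [← Finset.sum_mul, h1, one_mul]
      rw [Finset.sum_mul_sum, e1, e2]
      simp only [Finset.mul_sum, ← Finset.sum_sub_distrib, ← Finset.sum_add_distrib]
      refine Finset.sum_congr rfl fun i _ => Finset.sum_congr rfl fun j _ => ?_
      have := hz i j
      have := hm l j
      have := hmb k i
      rw [add_comm (z j) (z i)]
      field_simp
      ring
    rw [Matrix.sub_apply, hs, ← hkl, mul_right_comm, hsum, hE, hF, Matrix.mul_diagonal,
      Matrix.diagonal_mul]
    ring
  have hP : (Matrix.of fun i j => 1 / (z i + z j) -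
      (fun k => av k / (m k + z i)) ⬝ᵥ (Ab * G) *ᵥ (fun k => αv k / (mb k - z j))) =
      C * (1 - D * C * D * (V * (Ab * G * U))) := by
    rw [Matrix.mul_sub, ← Matrix.mul_assoc, hCD, Matrix.one_mul, Matrix.mul_one]
    rfl
  have hfac : 1 + E * A * F * Ab = (1 + A * Ab) * (1 - G * U * (D * C * D * V * Ab)) := by
    rw [hEAF, Matrix.mul_sub, Matrix.mul_assoc G, ← Matrix.mul_assoc (1 + A * Ab) G, hGu]
    simp only [Matrix.mul_one, Matrix.one_mul, Matrix.sub_mul, Matrix.mul_assoc]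
    abel
  rw [hP, Matrix.det_mul]
  rw [Matrix.det_one_add_mul_comm, ← Matrix.mul_assoc, ← Matrix.mul_assoc, hfac, Matrix.det_mul,
    Matrix.det_one_sub_mul_comm]
  simp only [Matrix.mul_assoc]
  ring

/-- The normalized two-point function `1 - (ξ + η) ⟨a|(M + ξ)⁻¹ Ā (1 + AĀ)⁻¹ (M̄ - η)⁻¹|α⟩`. -/
def dressedKernel {N : ℕ} (m mb αv av : Fin N → ℝ) (A Ab : Matrix (Fin N) (Fin N) ℝ)
    (ξ η : ℝ) : ℝ :=
  1 - (ξ + η) * ((fun k => av k / (m k + ξ)) ⬝ᵥ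
    (Ab * (1 + A * Ab)⁻¹) *ᵥ (fun k => αv k / (mb k - η)))

theorem dressedKernel_rank_two {N : ℕ} (m mb αv αb av ab : Fin N → ℝ)
    (A Ab : Matrix (Fin N) (Fin N) ℝ)
    (hA : Matrix.diagonal mb * A - A * Matrix.diagonal m = Matrix.vecMulVec αv av)
    (hAb : Matrix.diagonal m * Ab - Ab * Matrix.diagonal mb = Matrix.vecMulVec αb ab)
    (hG : IsUnit (1 + A * Ab)) :
    ∃ x y u v : ℝ → ℝ, ∀ ξ η, (∀ k, m k + ξ ≠ 0) → (∀ k, mb k - η ≠ 0) →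
      dressedKernel m mb αv av A Ab ξ η = x ξ * y η + u ξ * v η := by
  unfold dressedKernel
  set G := (1 + A * Ab)⁻¹ with hGdef
  have hGu : (1 + A * Ab) * G = 1 := Matrix.mul_nonsing_inv _ ((Matrix.isUnit_iff_isUnit_det _).1 hG)
  have hGu' : G * (1 + A * Ab) = 1 := Matrix.nonsing_inv_mul _ ((Matrix.isUnit_iff_isUnit_det _).1 hG)
  set M := Matrix.diagonal m with hM
  set Mb := Matrix.diagonal mb with hMb
  set X := Ab * G with hX
  have hcomm : Mb * G - G * Mb = - (G * (vecMulVec αv av * Ab + A * vecMulVec αb ab) * G) := by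
    have e : vecMulVec αv av * Ab + A * vecMulVec αb ab =
        Mb * (1 + A * Ab) - (1 + A * Ab) * Mb := by
      rw [← hA, ← hAb]; noncomm_ring
    rw [e, Matrix.mul_sub, Matrix.sub_mul, ← Matrix.mul_assoc G (1 + A * Ab), hGu']
    rw [Matrix.mul_assoc G, Matrix.mul_assoc Mb, hGu]
    simp
  have hMX : M * X - X * Mb = vecMulVec (αb - X *ᵥ (A *ᵥ αb)) (ab ᵥ* G) -
      vecMulVec (X *ᵥ αv) (av ᵥ* X) := by
    have : M * X - X * Mb = (M * Ab - Ab * Mb) * G + Ab * (Mb * G - G * Mb) := by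
      rw [hX]; noncomm_ring
    rw [this, hcomm, hAb, sub_vecMulVec, hX]
    simp only [← Matrix.vecMulVec_mul, ← Matrix.mul_vecMulVec]
    noncomm_ring
  refine ⟨fun ξ => 1 + (fun k => av k / (m k + ξ)) ⬝ᵥ X *ᵥ αv,
    fun η => 1 - av ⬝ᵥ X *ᵥ (fun k => αv k / (mb k - η)),
    fun ξ => (fun k => av k / (m k + ξ)) ⬝ᵥ (αb - X *ᵥ (A *ᵥ αb)),
    fun η => (ab ᵥ* G) ⬝ᵥ (fun k => αv k / (mb k - η)), fun ξ η hξ hη => ?_⟩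
  set a' : Fin N → ℝ := fun k => av k / (m k + ξ) with ha'
  set b' : Fin N → ℝ := fun k => αv k / (mb k - η) with hb'
  have h1 : a' ᵥ* M = av - ξ • a' := by
    ext k
    simp only [hM, Matrix.vecMul_diagonal, ha', Pi.sub_apply, Pi.smul_apply, smul_eq_mul]
    have := hξ k
    field_simp
    ring
  have h2 : Mb *ᵥ b' = αv + η • b' := by
    ext k
    simp only [hMb, Matrix.mulVec_diagonal, hb', Pi.add_apply, Pi.smul_apply, smul_eq_mul]
    have := hη k
    field_simp
    ring
  have h3 := congrArg (fun Z => a' ⬝ᵥ Z *ᵥ b') hMX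
  simp only [Matrix.sub_mulVec, ← Matrix.mulVec_mulVec, h2, dotProduct_sub,
    Matrix.vecMulVec_mulVec, Matrix.mulVec_add, dotProduct_add, Matrix.mulVec_smul,
    dotProduct_smul] at h3
  rw [Matrix.dotProduct_mulVec a' M, h1, sub_dotProduct, smul_dotProduct,
    ← Matrix.dotProduct_mulVec av X] at h3
  simp only [smul_eq_mul, MulOpposite.smul_eq_mul_unop, MulOpposite.unop_op] at h3
  simp only [dotProduct_sub]
  linear_combination h3

theorem fay_coeff_empty (a b c d : ℝ)
    (ha : a ≠ 0) (hb : b ≠ 0) (hc : c ≠ 0) (hd : d ≠ 0) (hab : a + b ≠ 0) (hac : a + c ≠ 0)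
    (had : a + d ≠ 0) (hbc : b + c ≠ 0) (hbd : b + d ≠ 0) (hcd : c + d ≠ 0) :
    (a + a)⁻¹ * ((b + b)⁻¹ * (c + c)⁻¹ * (d + d)⁻¹ - (b + b)⁻¹ * (c + d)⁻¹ * (c + d)⁻¹ - (b +
      c)⁻¹ * (b + c)⁻¹ * (d + d)⁻¹ + (b + c)⁻¹ * (c + d)⁻¹ * (b + d)⁻¹ + (b + d)⁻¹ * (b + c)⁻¹ *
      (c + d)⁻¹ - (b + d)⁻¹ * (c + c)⁻¹ * (b + d)⁻¹) - (a + b)⁻¹ * ((a + b)⁻¹ * (c + c)⁻¹ * (d +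
      d)⁻¹ - (a + b)⁻¹ * (c + d)⁻¹ * (c + d)⁻¹ - (b + c)⁻¹ * (a + c)⁻¹ * (d + d)⁻¹ + (b + c)⁻¹ *
      (c + d)⁻¹ * (a + d)⁻¹ + (b + d)⁻¹ * (a + c)⁻¹ * (c + d)⁻¹ - (b + d)⁻¹ * (c + c)⁻¹ * (a +
      d)⁻¹) + (a + c)⁻¹ * ((a + b)⁻¹ * (b + c)⁻¹ * (d + d)⁻¹ - (a + b)⁻¹ * (c + d)⁻¹ * (b +
      d)⁻¹ - (b + b)⁻¹ * (a + c)⁻¹ * (d + d)⁻¹ + (b + b)⁻¹ * (c + d)⁻¹ * (a + d)⁻¹ + (b + d)⁻¹ *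
      (a + c)⁻¹ * (b + d)⁻¹ - (b + d)⁻¹ * (b + c)⁻¹ * (a + d)⁻¹) - (a + d)⁻¹ * ((a + b)⁻¹ * (b +
      c)⁻¹ * (c + d)⁻¹ - (a + b)⁻¹ * (c + c)⁻¹ * (b + d)⁻¹ - (b + b)⁻¹ * (a + c)⁻¹ * (c + d)⁻¹ +
      (b + b)⁻¹ * (c + c)⁻¹ * (a + d)⁻¹ + (b + c)⁻¹ * (a + c)⁻¹ * (b + d)⁻¹ - (b + c)⁻¹ * (b +
      c)⁻¹ * (a + d)⁻¹) =
      ((a - c) * (a + c)⁻¹) * ((a - d) * (a + d)⁻¹) * ((b - c) * (b + c)⁻¹) * ((b - d) * (b +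
        d)⁻¹) * ((a + a)⁻¹ * (b + b)⁻¹ - (a + b)⁻¹ * (a + b)⁻¹) * ((c + c)⁻¹ * (d + d)⁻¹ - (c +
        d)⁻¹ * (c + d)⁻¹) -
      ((a - b) * (a + b)⁻¹) * ((a - d) * (a + d)⁻¹) * ((b - c) * (b + c)⁻¹) * ((c - d) * (c +
        d)⁻¹) * ((a + a)⁻¹ * (c + c)⁻¹ - (a + c)⁻¹ * (a + c)⁻¹) * ((b + b)⁻¹ * (d + d)⁻¹ - (b +
        d)⁻¹ * (b + d)⁻¹) +
      ((a - b) * (a + b)⁻¹) * ((a - c) * (a + c)⁻¹) * ((b - d) * (b + d)⁻¹) * ((c - d) * (c +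
        d)⁻¹) * ((a + a)⁻¹ * (d + d)⁻¹ - (a + d)⁻¹ * (a + d)⁻¹) * ((b + b)⁻¹ * (c + c)⁻¹ - (b +
        c)⁻¹ * (b + c)⁻¹) := by
  simp only [← two_mul]
  field_simp
  ring

theorem fay_coeff_diag (a b c d : ℝ)
    (ha : a ≠ 0) (hb : b ≠ 0) (hc : c ≠ 0) (hd : d ≠ 0) (hab : a + b ≠ 0) (hac : a + c ≠ 0)
    (had : a + d ≠ 0) (hbc : b + c ≠ 0) (hbd : b + d ≠ 0) (hcd : c + d ≠ 0) :
    (a + a)⁻¹ * ((b + b)⁻¹ * (c + c)⁻¹ * (d + d)⁻¹ - (b + b)⁻¹ * (c + d)⁻¹ * (c + d)⁻¹ - (b +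
      c)⁻¹ * (b + c)⁻¹ * (d + d)⁻¹ + (b + c)⁻¹ * (c + d)⁻¹ * (b + d)⁻¹ + (b + d)⁻¹ * (b + c)⁻¹ *
      (c + d)⁻¹ - (b + d)⁻¹ * (c + c)⁻¹ * (b + d)⁻¹) =
      ((a - c) * (a + c)⁻¹) * ((a - d) * (a + d)⁻¹) * ((b - c) * (b + c)⁻¹) * ((b - d) * (b +
        d)⁻¹) * ((a + a)⁻¹ * (b + b)⁻¹) * ((c + c)⁻¹ * (d + d)⁻¹ - (c + d)⁻¹ * (c + d)⁻¹) -
      ((a - b) * (a + b)⁻¹) * ((a - d) * (a + d)⁻¹) * ((b - c) * (b + c)⁻¹) * ((c - d) * (c +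
        d)⁻¹) * ((a + a)⁻¹ * (c + c)⁻¹) * ((b + b)⁻¹ * (d + d)⁻¹ - (b + d)⁻¹ * (b + d)⁻¹) +
      ((a - b) * (a + b)⁻¹) * ((a - c) * (a + c)⁻¹) * ((b - d) * (b + d)⁻¹) * ((c - d) * (c +
        d)⁻¹) * ((a + a)⁻¹ * (d + d)⁻¹) * ((b + b)⁻¹ * (c + c)⁻¹ - (b + c)⁻¹ * (b + c)⁻¹) := by
  simp only [← two_mul]
  field_simp
  ring

theorem fay_coeff_off (a b c d : ℝ)
    (hc : c ≠ 0) (hd : d ≠ 0) (hab : a + b ≠ 0) (hac : a + c ≠ 0)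
    (had : a + d ≠ 0) (hbc : b + c ≠ 0) (hbd : b + d ≠ 0) (hcd : c + d ≠ 0) :
    -((a + b)⁻¹ * ((a + b)⁻¹ * (c + c)⁻¹ * (d + d)⁻¹ - (a + b)⁻¹ * (c + d)⁻¹ * (c + d)⁻¹ - (b +
      c)⁻¹ * (a + c)⁻¹ * (d + d)⁻¹ + (b + c)⁻¹ * (c + d)⁻¹ * (a + d)⁻¹ + (b + d)⁻¹ * (a + c)⁻¹ *
      (c + d)⁻¹ - (b + d)⁻¹ * (c + c)⁻¹ * (a + d)⁻¹)) =
      ((a - c) * (a + c)⁻¹) * ((a - d) * (a + d)⁻¹) * ((b - c) * (b + c)⁻¹) * ((b - d) * (b +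
        d)⁻¹) * (-((a + b)⁻¹ * (a + b)⁻¹)) * ((c + c)⁻¹ * (d + d)⁻¹ - (c + d)⁻¹ * (c + d)⁻¹) := by
  simp only [← two_mul]
  field_simp
  ring

theorem fay_coeff_pair (a b c d : ℝ)
    (ha : a ≠ 0) (hb : b ≠ 0) (hc : c ≠ 0) (hd : d ≠ 0) (hab : a + b ≠ 0) (hac : a + c ≠ 0)
    (had : a + d ≠ 0) (hbc : b + c ≠ 0) (hbd : b + d ≠ 0) (hcd : c + d ≠ 0) :
    ((a + a)⁻¹ * (b + b)⁻¹ - (a + b)⁻¹ * (a + b)⁻¹) * ((c + c)⁻¹ * (d + d)⁻¹ - (c + d)⁻¹ * (c +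
      d)⁻¹) =
      ((a - c) * (a + c)⁻¹) * ((a - d) * (a + d)⁻¹) * ((b - c) * (b + c)⁻¹) * ((b - d) * (b +
        d)⁻¹) * ((a + a)⁻¹ * (b + b)⁻¹ - (a + b)⁻¹ * (a + b)⁻¹) * ((c + c)⁻¹ * (d + d)⁻¹ - (c +
        d)⁻¹ * (c + d)⁻¹) -
      ((a - b) * (a + b)⁻¹) * ((a - d) * (a + d)⁻¹) * ((b - c) * (b + c)⁻¹) * ((c - d) * (c +
        d)⁻¹) * ((a + a)⁻¹ * (b + b)⁻¹ * (c + c)⁻¹ * (d + d)⁻¹) +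
      ((a - b) * (a + b)⁻¹) * ((a - c) * (a + c)⁻¹) * ((b - d) * (b + d)⁻¹) * ((c - d) * (c +
        d)⁻¹) * ((a + a)⁻¹ * (b + b)⁻¹ * (c + c)⁻¹ * (d + d)⁻¹) := by
  simp only [← two_mul]
  field_simp
  ring

theorem fay_coeff_overlap (a b c d : ℝ)
    (ha : a ≠ 0) (hd : d ≠ 0) (hab : a + b ≠ 0) (hac : a + c ≠ 0)
    (hbc : b + c ≠ 0) (hbd : b + d ≠ 0) (hcd : c + d ≠ 0) :
    -(((a + a)⁻¹ * (b + c)⁻¹ - (a + c)⁻¹ * (a + b)⁻¹) * ((b + c)⁻¹ * (d + d)⁻¹ - (c + d)⁻¹ * (b +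
      d)⁻¹)) =
      ((a - b) * (a + b)⁻¹) * ((a - c) * (a + c)⁻¹) * ((b - d) * (b + d)⁻¹) * ((c - d) * (c +
        d)⁻¹) * ((a + a)⁻¹ * (d + d)⁻¹) * (-((b + c)⁻¹ * (b + c)⁻¹)) := by
  simp only [← two_mul]
  field_simp
  ring

theorem fay_four (a b c d : ℝ)
    (ha : a ≠ 0) (hb : b ≠ 0) (hc : c ≠ 0) (hd : d ≠ 0) (hab : a + b ≠ 0) (hac : a + c ≠ 0)
    (had : a + d ≠ 0) (hbc : b + c ≠ 0) (hbd : b + d ≠ 0) (hcd : c + d ≠ 0)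
    (u1 u2 u3 v1 v2 v3 x1 x2 x3 x4 y1 y2 y3 y4 : ℝ) :
    (!![(x1 * y1 + u1 * v1) * (a + a)⁻¹, (x1 * y2 + u1 * v2) * (a + b)⁻¹, (x1 * y3 + u1 * v3) *
      (a + c)⁻¹, (x1 * y4) * (a + d)⁻¹;
      (x2 * y1 + u2 * v1) * (a + b)⁻¹, (x2 * y2 + u2 * v2) * (b + b)⁻¹, (x2 * y3 + u2 * v3) *
        (b + c)⁻¹, (x2 * y4) * (b + d)⁻¹;
      (x3 * y1 + u3 * v1) * (a + c)⁻¹, (x3 * y2 + u3 * v2) * (b + c)⁻¹, (x3 * y3 + u3 * v3) *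
        (c + c)⁻¹, (x3 * y4) * (c + d)⁻¹;
      (x4 * y1) * (a + d)⁻¹, (x4 * y2) * (b + d)⁻¹, (x4 * y3) * (c + d)⁻¹, (x4 * y4) * (d +
        d)⁻¹] : Matrix _ _ ℝ).det =
      ((a - c) * (a + c)⁻¹) * ((a - d) * (a + d)⁻¹) * ((b - c) * (b + c)⁻¹) * ((b - d) * (b +
        d)⁻¹) * (((x1 * y1 + u1 * v1) * (a + a)⁻¹) * ((x2 * y2 + u2 * v2) * (b + b)⁻¹) - ((x1 *
        y2 + u1 * v2) * (a + b)⁻¹) * ((x2 * y1 + u2 * v1) * (a + b)⁻¹)) * (((x3 * y3 + u3 * v3) *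
        (c + c)⁻¹) * ((x4 * y4) * (d + d)⁻¹) - ((x3 * y4) * (c + d)⁻¹) * ((x4 * y3) * (c + d)⁻¹)) -
      ((a - b) * (a + b)⁻¹) * ((a - d) * (a + d)⁻¹) * ((b - c) * (b + c)⁻¹) * ((c - d) * (c +
        d)⁻¹) * (((x1 * y1 + u1 * v1) * (a + a)⁻¹) * ((x3 * y3 + u3 * v3) * (c + c)⁻¹) - ((x1 *
        y3 + u1 * v3) * (a + c)⁻¹) * ((x3 * y1 + u3 * v1) * (a + c)⁻¹)) * (((x2 * y2 + u2 * v2) *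
        (b + b)⁻¹) * ((x4 * y4) * (d + d)⁻¹) - ((x2 * y4) * (b + d)⁻¹) * ((x4 * y2) * (b + d)⁻¹)) +
      ((a - b) * (a + b)⁻¹) * ((a - c) * (a + c)⁻¹) * ((b - d) * (b + d)⁻¹) * ((c - d) * (c +
        d)⁻¹) * (((x1 * y1 + u1 * v1) * (a + a)⁻¹) * ((x4 * y4) * (d + d)⁻¹) - ((x1 * y4) * (a +
        d)⁻¹) * ((x4 * y1) * (a + d)⁻¹)) * (((x2 * y2 + u2 * v2) * (b + b)⁻¹) * ((x3 * y3 + u3 *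
        v3) * (c + c)⁻¹) - ((x2 * y3 + u2 * v3) * (b + c)⁻¹) * ((x3 * y2 + u3 * v2) * (b +
        c)⁻¹)) := by
  simp [Matrix.det_succ_row_zero, Fin.sum_univ_succ, Fin.succAbove]
  linear_combination
    x1*x2*x3*x4*y1*y2*y3 * y4 * fay_coeff_empty a b c d ha hb hc hd hab hac had hbc hbd hcd +
    u1*x2*x3*x4*v1*y2*y3 * y4 * fay_coeff_diag a b c d ha hb hc hd hab hac had hbc hbd hcd +
    u1*x2*x3*x4*y1*v2*y3 * y4 * fay_coeff_off a b c d hc hd hab hac had hbc hbd hcd +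
    u1*x2*x3*x4*y1*y2*v3 * y4 * fay_coeff_off a c b d hb hd hac hab had (add_comm b c ▸ hbc) hcd
      hbd +
    x1*u2*x3*x4*v1*y2*y3 * y4 * fay_coeff_off b a c d hc hd (add_comm a b ▸ hab) hbc hbd hac had
      hcd +
    x1*u2*x3*x4*y1*v2*y3 * y4 * fay_coeff_diag b a c d hb ha hc hd (add_comm a b ▸ hab) hbc hbd hac
      had hcd +
    x1*u2*x3*x4*y1*y2*v3 * y4 * fay_coeff_off b c a d ha hd hbc (add_comm a b ▸ hab) hbd (add_comm
      a c ▸ hac) hcd had +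
    x1*x2*u3*x4*v1*y2*y3 * y4 * fay_coeff_off c a b d hb hd (add_comm a c ▸ hac) (add_comm b c ▸
      hbc) hcd hab had hbd +
    x1*x2*u3*x4*y1*v2*y3 * y4 * fay_coeff_off c b a d ha hd (add_comm b c ▸ hbc) (add_comm a c ▸
      hac) hcd (add_comm a b ▸ hab) hbd had +
    x1*x2*u3*x4*y1*y2*v3 * y4 * fay_coeff_diag c a b d hc ha hb hd (add_comm a c ▸ hac) (add_comm b
      c ▸ hbc) hcd hab had hbd +
    u1*u2*x3*x4*v1*v2*y3 * y4 * fay_coeff_pair a b c d ha hb hc hd hab hac had hbc hbd hcd +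
    u1*u2*x3*x4*v1*y2*v3 * y4 * fay_coeff_overlap a b c d ha hd hab hac hbc hbd hcd +
    u1*u2*x3*x4*y1*v2*v3 * y4 * fay_coeff_overlap b a c d hb hd (add_comm a b ▸ hab) hbc hac had
      hcd +
    u1*x2*u3*x4*v1*v2*y3 * y4 * fay_coeff_overlap a c b d ha hd hac hab (add_comm b c ▸ hbc) hcd
      hbd +
    u1*x2*u3*x4*v1*y2*v3 * y4 * fay_coeff_pair a c b d ha hc hb hd hac hab had (add_comm b c ▸ hbc)
      hcd hbd +
    u1*x2*u3*x4*y1*v2*v3 * y4 * fay_coeff_overlap c a b d hc hd (add_comm a c ▸ hac) (add_comm b c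
      ▸ hbc) hab had hbd +
    x1*u2*u3*x4*v1*v2*y3 * y4 * fay_coeff_overlap b c a d hb hd hbc (add_comm a b ▸ hab) (add_comm
      a c ▸ hac) hcd had +
    x1*u2*u3*x4*v1*y2*v3 * y4 * fay_coeff_overlap c b a d hc hd (add_comm b c ▸ hbc) (add_comm a c
      ▸ hac) (add_comm a b ▸ hab) hbd had +
    x1*u2*u3*x4*y1*v2*v3 * y4 * fay_coeff_pair b c a d hb hc ha hd hbc (add_comm a b ▸ hab) hbd
      (add_comm a c ▸ hac) hcd had +
    u1*u2*u3*x4*v1*v2*v3 * y4 * fay_coeff_diag d a b c hd ha hb hc (add_comm a d ▸ had) (add_comm b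
      d ▸ hbd) (add_comm c d ▸ hcd) hab hac hbc

/-- Pfaffian-type expansion of a four-point Cauchy-like determinant with a rank-two numerator. -/
theorem det_kernel_cauchy_four (K : ℝ → ℝ → ℝ) (x y u v : ℝ → ℝ) (a b c d : ℝ)
    (ha : a ≠ 0) (hb : b ≠ 0) (hc : c ≠ 0) (hd : d ≠ 0) (hab : a + b ≠ 0) (hac : a + c ≠ 0)
    (had : a + d ≠ 0) (hbc : b + c ≠ 0) (hbd : b + d ≠ 0) (hcd : c + d ≠ 0)
    (hK : ∀ s ∈ [a, b, c, d], ∀ t ∈ [a, b, c, d], K s t = x s * y t + u s * v t)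
    (hp : K d d ≠ 0) :
    (Matrix.of fun i j => K (![a, b, c, d] i) (![a, b, c, d] j) *
        (![a, b, c, d] i + ![a, b, c, d] j)⁻¹).det =
      ((a - c) * (a + c)⁻¹) * ((a - d) * (a + d)⁻¹) * ((b - c) * (b + c)⁻¹) * ((b - d) * (b +
        d)⁻¹) *
        (K a a * (a + a)⁻¹ * (K b b * (b + b)⁻¹) - K a b * (a + b)⁻¹ * (K b a * (a + b)⁻¹)) *
        (K c c * (c + c)⁻¹ * (K d d * (d + d)⁻¹) - K c d * (c + d)⁻¹ * (K d c * (c + d)⁻¹)) -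
      ((a - b) * (a + b)⁻¹) * ((a - d) * (a + d)⁻¹) * ((b - c) * (b + c)⁻¹) * ((c - d) * (c +
        d)⁻¹) *
        (K a a * (a + a)⁻¹ * (K c c * (c + c)⁻¹) - K a c * (a + c)⁻¹ * (K c a * (a + c)⁻¹)) *
        (K b b * (b + b)⁻¹ * (K d d * (d + d)⁻¹) - K b d * (b + d)⁻¹ * (K d b * (b + d)⁻¹)) +
      ((a - b) * (a + b)⁻¹) * ((a - c) * (a + c)⁻¹) * ((b - d) * (b + d)⁻¹) * ((c - d) * (c +
        d)⁻¹) *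
        (K a a * (a + a)⁻¹ * (K d d * (d + d)⁻¹) - K a d * (a + d)⁻¹ * (K d a * (a + d)⁻¹)) *
        (K b b * (b + b)⁻¹ * (K c c * (c + c)⁻¹) - K b c * (b + c)⁻¹ * (K c b * (b + c)⁻¹)) := by
  have e : ∀ s ∈ [a, b, c, d], ∀ t ∈ [a, b, c, d],
      K s d * (K d t / K d d) + (u s * x d - x s * u d) * ((v t * y d - y t * v d) / K d d) =
        K s t := fun s hs t ht => by
    field_simp
    rw [hK s hs d (by simp), hK d (by simp) t ht, hK s hs t ht, hK d (by simp) d (by simp)]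
    ring
  have key := fay_four a b c d ha hb hc hd hab hac had hbc hbd hcd
    (u a * x d - x a * u d) (u b * x d - x b * u d) (u c * x d - x c * u d)
    ((v a * y d - y a * v d) / K d d) ((v b * y d - y b * v d) / K d d) ((v c * y d - y c *
      v d) / K d d)
    (K a d) (K b d) (K c d) (K d d) (K d a / K d d) (K d b / K d d) (K d c / K d d) 1
  simp only [List.forall_mem_cons, List.not_mem_nil, IsEmpty.forall_iff, implies_true,
    and_true] at e
  simp only [e, mul_one, mul_div_cancel₀ _ hp] at key
  rw [← key]
  congr 1
  ext i j
  fin_cases i <;> fin_cases j <;> simp [add_comm]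

theorem Hmat_eq_diagonal {N : ℕ} (m : Fin N → ℝ) (ζ : ℝ) (h : ∀ k, m k + ζ ≠ 0) :
    Hmat m ζ = Matrix.diagonal fun k => (m k - ζ) / (m k + ζ) := by
  have hinv : (Matrix.diagonal m + ζ • 1)⁻¹ = Matrix.diagonal fun k => (m k + ζ)⁻¹ := by
    apply Matrix.inv_eq_right_inv
    rw [Matrix.smul_one_eq_diagonal, Matrix.diagonal_add, Matrix.diagonal_mul_diagonal,
      ← Matrix.diagonal_one]
    exact congrArg _ (funext fun k => mul_inv_cancel₀ (h k))
  rw [Hmat, hinv, Matrix.smul_one_eq_diagonal, Matrix.diagonal_sub, Matrix.diagonal_mul_diagonal]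
  rfl

theorem Hbmat_eq_Hmat {N : ℕ} (mb : Fin N → ℝ) (ζ : ℝ) : Hbmat mb ζ = Hmat mb (-ζ) := by
  simp [Hbmat, Hmat, sub_eq_add_neg]

theorem Hmat_list_prod {N : ℕ} (m : Fin N → ℝ) (S : List ℝ) (h : ∀ ζ ∈ S, ∀ k, m k + ζ ≠ 0) :
    (S.map (Hmat m)).prod =
      Matrix.diagonal fun k => (S.map fun ζ => (m k - ζ) / (m k + ζ)).prod := by
  induction S with
  | nil => simp
  | cons ζ S ih =>
    rw [List.map_cons, List.prod_cons, ih fun η hη => h η (List.mem_cons_of_mem _ hη),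
      Hmat_eq_diagonal m ζ (h ζ List.mem_cons_self), Matrix.diagonal_mul_diagonal]
    rfl

theorem tauL_nil {N : ℕ} (m mb : Fin N → ℝ) (A Ab : Matrix (Fin N) (Fin N) ℝ) :
    tauL m mb A Ab [] = (1 + A * Ab).det := by
  simp [tauL]

/-- Determinant formula for the Miwa-shifted tau-function, the shift being encoded by the residues
`r` of `∏ i, (t - z i) / (t + z i)`. -/
theorem tauL_mul_det_cauchy {N n : ℕ} (m mb αv av : Fin N → ℝ)
    (A Ab : Matrix (Fin N) (Fin N) ℝ)
    (hA : Matrix.diagonal mb * A - A * Matrix.diagonal m = Matrix.vecMulVec αv av)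
    (hG : IsUnit (1 + A * Ab)) (z r : Fin n → ℝ)
    (hz : ∀ i j, z i + z j ≠ 0)
    (hm : ∀ k i, m k + z i ≠ 0) (hmb : ∀ k i, mb k - z i ≠ 0)
    (hpf : ∀ t, (∀ i, t + z i ≠ 0) →
      ∏ i, (t - z i) / (t + z i) = 1 - ∑ i, r i / (t + z i))
    (hr : ∀ j, r j * ∑ i, r i / (z j + z i) ^ 2 = 1)
    (hinj : Function.Injective z) :
    tauL m mb A Ab (List.ofFn z) * (Matrix.of fun i j => (z i + z j)⁻¹).det =
      tauL m mb A Ab [] *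
        (Matrix.of fun i j => dressedKernel m mb αv av A Ab (z i) (z j) * (z i + z j)⁻¹).det := by
  have hsum : ∀ j, ∑ i, r i / (z j + z i) = 1 := fun j => by
    have := hpf (z j) (hz j)
    rw [Finset.prod_eq_zero (Finset.mem_univ j) (by simp)] at this
    linarith
  have hf : (List.map (Hmat m) (List.ofFn z)).prod =
      Matrix.diagonal fun k => 1 - ∑ i, r i / (m k + z i) := by
    rw [Hmat_list_prod]
    · congr 1
      funext k
      rw [List.map_ofFn, List.prod_ofFn, ← hpf (m k) (hm k)]
      rfl
    · intro ζ hζ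
      obtain ⟨i, rfl⟩ := (List.mem_ofFn' _ _).1 hζ
      exact fun k => hm k i
  have hg : (List.map (Hbmat mb) (List.ofFn z)).prod =
      Matrix.diagonal fun k => 1 + ∑ i, r i / (mb k - z i) := by
    have hneg : Hbmat mb = Hmat mb ∘ fun ζ => -ζ := funext (Hbmat_eq_Hmat mb)
    rw [hneg, ← List.map_map, List.map_ofFn, Hmat_list_prod]
    · congr 1
      funext k
      have hk : ∀ i, -mb k + z i = -(mb k - z i) := fun i => by ring
      have := hpf (-mb k) fun i => by rw [hk]; exact neg_ne_zero.2 (hmb k i)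
      simp only [hk, div_neg, Finset.sum_neg_distrib, sub_neg_eq_add] at this
      rw [List.map_ofFn, List.prod_ofFn, ← this]
      refine Finset.prod_congr rfl fun i _ => ?_
      simp only [Function.comp_apply]
      rw [← neg_div, ← sub_eq_add_neg]
      congr 1
      ring
    · intro ζ hζ
      obtain ⟨i, rfl⟩ := (List.mem_ofFn' _ _).1 hζ
      exact fun k => by simpa [sub_eq_add_neg] using hmb k i
  have key := det_one_add_mul_det_cauchy m mb αv av A Ab hA hG z r hz hm hmb hsum hr hinj
  rw [tauL_nil, tauL, hf, hg]
  simp only [one_div] at key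
  rw [key]
  congr 3
  ext i j
  simp only [dressedKernel]
  have := hz i j
  field_simp

theorem tauL_one {N : ℕ} (m mb αv av : Fin N → ℝ) (A Ab : Matrix (Fin N) (Fin N) ℝ)
    (hA : Matrix.diagonal mb * A - A * Matrix.diagonal m = Matrix.vecMulVec αv av)
    (hG : IsUnit (1 + A * Ab)) (a : ℝ) (ha : a ≠ 0)
    (hm : ∀ k, m k + a ≠ 0) (hmb : ∀ k, mb k - a ≠ 0) :
    tauL m mb A Ab [a] = tauL m mb A Ab [] * dressedKernel m mb αv av A Ab a a := by
  have h2 : a + a ≠ 0 := by simpa using ha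
  have key := tauL_mul_det_cauchy m mb αv av A Ab hA hG ![a] ![2 * a]
    (by simpa using h2) (by simpa using hm) (by simpa using hmb)
    (fun t ht => by
      have := ht 0
      simp only [Fin.isValue, Matrix.cons_val_fin_one, Finset.univ_unique, Finset.prod_const,
        Finset.card_singleton, pow_one, Finset.sum_const, one_smul] at this ⊢
      field_simp
      ring)
    (fun j => by
      simp only [Matrix.cons_val_fin_one, Finset.univ_unique, Finset.sum_const,
        Finset.card_singleton, one_smul]
      field_simp
      ring)
    (Function.injective_of_subsingleton _)
  simp only [Matrix.det_fin_one, Matrix.of_apply, Matrix.cons_val_fin_one, ← mul_assoc] at key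
  simpa using mul_right_cancel₀ (inv_ne_zero h2) key

theorem tauL_two {N : ℕ} (m mb αv av : Fin N → ℝ) (A Ab : Matrix (Fin N) (Fin N) ℝ)
    (hA : Matrix.diagonal mb * A - A * Matrix.diagonal m = Matrix.vecMulVec αv av)
    (hG : IsUnit (1 + A * Ab)) (a b : ℝ) (ha : a ≠ 0) (hb : b ≠ 0) (hab : a - b ≠ 0)
    (hab' : a + b ≠ 0)
    (hma : ∀ k, m k + a ≠ 0) (hmb : ∀ k, m k + b ≠ 0)
    (hmba : ∀ k, mb k - a ≠ 0) (hmbb : ∀ k, mb k - b ≠ 0) :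
    tauL m mb A Ab [a, b] * ((a - b) * (a + b)⁻¹) ^ 2 =
      tauL m mb A Ab [] * (4 * a * b) *
      (dressedKernel m mb αv av A Ab a a * (a + a)⁻¹ *
          (dressedKernel m mb αv av A Ab b b * (b + b)⁻¹) -
        dressedKernel m mb αv av A Ab a b * (a + b)⁻¹ *
          (dressedKernel m mb αv av A Ab b a * (a + b)⁻¹)) := by
  have h2a : a + a ≠ 0 := by simpa using ha
  have h2b : b + b ≠ 0 := by simpa using hb
  have hba' : b + a ≠ 0 := by rwa [add_comm]
  have key := tauL_mul_det_cauchy m mb αv av A Ab hA hG ![a, b]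
    ![2 * a * ((a + b) / (a - b)), -(2 * b * ((a + b) / (a - b)))]
    (by simp [Fin.forall_fin_two, *]) (by simp [Fin.forall_fin_two, *])
    (by simp [Fin.forall_fin_two, *])
    (fun t ht => by
      have h0 := ht 0
      have h1 := ht 1
      simp only [Fin.prod_univ_two, Fin.sum_univ_two, Matrix.cons_val] at h0 h1 ⊢
      field_simp
      ring)
    (by
      simp only [Fin.forall_fin_two, Fin.sum_univ_two, Matrix.cons_val, ← two_mul]
      constructor <;> field_simp <;> ring)
    (by
      intro i j
      have hne := sub_ne_zero.1 hab
      fin_cases i <;> fin_cases j <;> simp [hne, hne.symm])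
  simp only [Matrix.det_fin_two, Matrix.of_apply, Matrix.cons_val, List.ofFn_succ, List.ofFn_zero,
    Fin.succ_zero_eq_one] at key
  have hdet : ((a - b) * (a + b)⁻¹) ^ 2 =
      4 * a * b * ((a + a)⁻¹ * (b + b)⁻¹ - (a + b)⁻¹ * (b + a)⁻¹) := by
    rw [add_comm b a, ← two_mul, ← two_mul]
    field_simp
    ring
  rw [add_comm b a] at key hdet
  rw [hdet]
  linear_combination (4 * a * b) * key

theorem tauL_four {N : ℕ} (m mb αv av : Fin N → ℝ) (A Ab : Matrix (Fin N) (Fin N) ℝ)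
    (hA : Matrix.diagonal mb * A - A * Matrix.diagonal m = Matrix.vecMulVec αv av)
    (hG : IsUnit (1 + A * Ab)) (a b c d : ℝ)
    (ha : a ≠ 0) (hb : b ≠ 0) (hc : c ≠ 0) (hd : d ≠ 0)
    (hab : a - b ≠ 0) (hac : a - c ≠ 0) (had : a - d ≠ 0)
    (hbc : b - c ≠ 0) (hbd : b - d ≠ 0) (hcd : c - d ≠ 0)
    (hab' : a + b ≠ 0) (hac' : a + c ≠ 0) (had' : a + d ≠ 0)
    (hbc' : b + c ≠ 0) (hbd' : b + d ≠ 0) (hcd' : c + d ≠ 0)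
    (hm : ∀ k, ∀ i, m k + ![a, b, c, d] i ≠ 0) (hmb : ∀ k, ∀ i, mb k - ![a, b, c, d] i ≠ 0) :
    tauL m mb A Ab [a, b, c, d] *
      (((a - b) * (a + b)⁻¹) * ((a - c) * (a + c)⁻¹) * ((a - d) * (a + d)⁻¹) *
        ((b - c) * (b + c)⁻¹) * ((b - d) * (b + d)⁻¹) * ((c - d) * (c + d)⁻¹)) ^ 2 =
      tauL m mb A Ab [] * (16 * a * b * c * d) *
        (Matrix.of fun i j => dressedKernel m mb αv av A Ab (![a, b, c, d] i) (![a, b, c, d] j) *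
          (![a, b, c, d] i + ![a, b, c, d] j)⁻¹).det := by
  have hba := sub_ne_zero.2 (sub_ne_zero.1 hab).symm
  have hca := sub_ne_zero.2 (sub_ne_zero.1 hac).symm
  have hda := sub_ne_zero.2 (sub_ne_zero.1 had).symm
  have hcb := sub_ne_zero.2 (sub_ne_zero.1 hbc).symm
  have hdb := sub_ne_zero.2 (sub_ne_zero.1 hbd).symm
  have hdc := sub_ne_zero.2 (sub_ne_zero.1 hcd).symm
  have hba' : b + a ≠ 0 := by rwa [add_comm]
  have hca' : c + a ≠ 0 := by rwa [add_comm]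
  have hda' : d + a ≠ 0 := by rwa [add_comm]
  have hcb' : c + b ≠ 0 := by rwa [add_comm]
  have hdb' : d + b ≠ 0 := by rwa [add_comm]
  have hdc' : d + c ≠ 0 := by rwa [add_comm]
  have key := tauL_mul_det_cauchy m mb αv av A Ab hA hG ![a, b, c, d]
    ![cauchyWeight a b c d, cauchyWeight b a c d, cauchyWeight c a b d, cauchyWeight d a b c]
    (by simp [Fin.forall_fin_succ, ← two_mul, *])
    hm hmb
    (fun t ht => by
      have h0 := ht 0
      have h1 := ht 1
      have h2 := ht 2
      have h3 := ht 3
      simp only [Fin.prod_univ_four, Fin.sum_univ_four, Matrix.cons_val] at h0 h1 h2 h3 ⊢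
      rw [cauchyWeight_partial_fractions a b c d t hab hac had hbc hbd hcd h0 h1 h2 h3]
      ring)
    (by
      have e1 := cauchyWeight_sq_sum a b c d hab hac had hbc hbd hcd ha hab' hac' had'
      have e2 := cauchyWeight_sq_sum b a c d hba hbc hbd hac had hcd hb hba' hbc' hbd'
      have e3 := cauchyWeight_sq_sum c a b d hca hcb hcd hab had hbd hc hca' hcb' hcd'
      have e4 := cauchyWeight_sq_sum d a b c hda hdb hdc hab hac hbc hd hda' hdb' hdc'
      rw [cauchyWeight_swap_left c b, cauchyWeight_swap_left d b] at e2
      rw [cauchyWeight_swap_left a c, cauchyWeight_swap_left b c, cauchyWeight_swap_left d c,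
        cauchyWeight_swap_right d a] at e3
      rw [cauchyWeight_swap_left a d, cauchyWeight_swap_right a b, cauchyWeight_swap_left b d,
        cauchyWeight_swap_right b a, cauchyWeight_swap_left c d, cauchyWeight_swap_right c a] at e4
      simp only [Fin.forall_fin_succ, Fin.sum_univ_four, Matrix.cons_val, IsEmpty.forall_iff,
        and_true]
      refine ⟨e1, ?_, ?_, ?_⟩
      · change cauchyWeight b a c d * (cauchyWeight a b c d / (b + a) ^ 2 +
          cauchyWeight b a c d / (b + b) ^ 2 + cauchyWeight c a b d / (b + c) ^ 2 +
          cauchyWeight d a b c / (b + d) ^ 2) = 1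
        linear_combination e2
      · change cauchyWeight c a b d * (cauchyWeight a b c d / (c + a) ^ 2 +
          cauchyWeight b a c d / (c + b) ^ 2 + cauchyWeight c a b d / (c + c) ^ 2 +
          cauchyWeight d a b c / (c + d) ^ 2) = 1
        linear_combination e3
      · change cauchyWeight d a b c * (cauchyWeight a b c d / (d + a) ^ 2 +
          cauchyWeight b a c d / (d + b) ^ 2 + cauchyWeight c a b d / (d + c) ^ 2 +
          cauchyWeight d a b c / (d + d) ^ 2) = 1
        linear_combination e4)
    (by
      intro i j
      simp only [sub_ne_zero] at hab hac had hbc hbd hcd hba hca hda hcb hdb hdc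
      fin_cases i <;> fin_cases j <;> simp [*])
  have hdet : (((a - b) * (a + b)⁻¹) * ((a - c) * (a + c)⁻¹) * ((a - d) * (a + d)⁻¹) *
        ((b - c) * (b + c)⁻¹) * ((b - d) * (b + d)⁻¹) * ((c - d) * (c + d)⁻¹)) ^ 2 =
      16 * a * b * c * d *
        (Matrix.of fun i j => (![a, b, c, d] i + ![a, b, c, d] j)⁻¹).det := by
    simp [Matrix.det_succ_row_zero, Fin.sum_univ_succ, Fin.succAbove]
    rw [add_comm b a, add_comm c a, add_comm d a, add_comm c b, add_comm d b, add_comm d c]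
    simp only [← two_mul]
    field_simp
    ring
  have hlist : [a, b, c, d] = List.ofFn ![a, b, c, d] := by simp
  rw [hdet, hlist]
  linear_combination (16 * a * b * c * d) * key

theorem tau_satisfies_second_discrete_BKP
    {N : ℕ} (hN : 1 ≤ N) (m mb : Fin N → ℝ)
    (αv αb av ab : Fin N → ℝ)
    (A Ab : Matrix (Fin N) (Fin N) ℝ)
    (hA : Matrix.diagonal mb * A - A * Matrix.diagonal m = Matrix.vecMulVec αv av)
    (hAb : Matrix.diagonal m * Ab - Ab * Matrix.diagonal mb = Matrix.vecMulVec αb ab)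
    (α β γ δ : ℝ)
    (hαβ : α ≠ β) (hαγ : α ≠ γ) (hαδ : α ≠ δ)
    (hβγ : β ≠ γ) (hβδ : β ≠ δ) (hγδ : γ ≠ δ)
    (hα : α ≠ 0) (hβ : β ≠ 0) (hγ : γ ≠ 0) (hδ : δ ≠ 0)
    (hαβ' : α + β ≠ 0) (hαγ' : α + γ ≠ 0) (hαδ' : α + δ ≠ 0)
    (hβγ' : β + γ ≠ 0) (hβδ' : β + δ ≠ 0) (hγδ' : γ + δ ≠ 0)
    (hm : ∀ k, m k ≠ α ∧ m k ≠ -α ∧ m k ≠ β ∧ m k ≠ -β ∧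
      m k ≠ γ ∧ m k ≠ -γ ∧ m k ≠ δ ∧ m k ≠ -δ)
    (hmb : ∀ k, mb k ≠ α ∧ mb k ≠ -α ∧ mb k ≠ β ∧ mb k ≠ -β ∧
      mb k ≠ γ ∧ mb k ≠ -γ ∧ mb k ≠ δ ∧ mb k ≠ -δ)
    (hG : IsUnit ((1 : Matrix (Fin N) (Fin N) ℝ) + A * Ab))
    (hτδ : tauL m mb A Ab [δ] ≠ 0) :
    tauL m mb A Ab [] * tauL m mb A Ab [α, β, γ, δ] =
      ((α + β) / (α - β)) * ((α + γ) / (α - γ)) *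
        ((δ + β) / (δ - β)) * ((δ + γ) / (δ - γ)) *
        tauL m mb A Ab [α, δ] * tauL m mb A Ab [β, γ] +
      ((β + α) / (β - α)) * ((β + γ) / (β - γ)) *
        ((δ + α) / (δ - α)) * ((δ + γ) / (δ - γ)) *
        tauL m mb A Ab [β, δ] * tauL m mb A Ab [α, γ] +
      ((γ + α) / (γ - α)) * ((γ + β) / (γ - β)) *
        ((δ + α) / (δ - α)) * ((δ + β) / (δ - β)) *
        tauL m mb A Ab [γ, δ] * tauL m mb A Ab [α, β] := by
  have hm' : ∀ {p q : ℝ}, p ≠ -q → p + q ≠ 0 := fun h h' => h (eq_neg_of_add_eq_zero_left h')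
  have hab := sub_ne_zero.2 hαβ
  have hac := sub_ne_zero.2 hαγ
  have had := sub_ne_zero.2 hαδ
  have hbc := sub_ne_zero.2 hβγ
  have hbd := sub_ne_zero.2 hβδ
  have hcd := sub_ne_zero.2 hγδ
  have mα : ∀ k, m k + α ≠ 0 := fun k => hm' (hm k).2.1
  have mβ : ∀ k, m k + β ≠ 0 := fun k => hm' (hm k).2.2.2.1
  have mγ : ∀ k, m k + γ ≠ 0 := fun k => hm' (hm k).2.2.2.2.2.1
  have mδ : ∀ k, m k + δ ≠ 0 := fun k => hm' (hm k).2.2.2.2.2.2.2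
  have nα : ∀ k, mb k - α ≠ 0 := fun k => sub_ne_zero.2 (hmb k).1
  have nβ : ∀ k, mb k - β ≠ 0 := fun k => sub_ne_zero.2 (hmb k).2.2.1
  have nγ : ∀ k, mb k - γ ≠ 0 := fun k => sub_ne_zero.2 (hmb k).2.2.2.2.1
  have nδ : ∀ k, mb k - δ ≠ 0 := fun k => sub_ne_zero.2 (hmb k).2.2.2.2.2.2.1
  obtain ⟨x, y, u, v, hw⟩ := dressedKernel_rank_two m mb αv αb av ab A Ab hA hAb hG
  have two := tauL_two m mb αv av A Ab hA hG
  have t12 := two α β hα hβ hab hαβ' mα mβ nα nβ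
  have t13 := two α γ hα hγ hac hαγ' mα mγ nα nγ
  have t14 := two α δ hα hδ had hαδ' mα mδ nα nδ
  have t23 := two β γ hβ hγ hbc hβγ' mβ mγ nβ nγ
  have t24 := two β δ hβ hδ hbd hβδ' mβ mδ nβ nδ
  have t34 := two γ δ hγ hδ hcd hγδ' mγ mδ nγ nδ
  have t4 := tauL_four m mb αv av A Ab hA hG α β γ δ hα hβ hγ hδ hab hac had hbc hbd hcd
    hαβ' hαγ' hαδ' hβγ' hβδ' hγδ'
    (by simp [Fin.forall_fin_succ, *]) (by simp [Fin.forall_fin_succ, *])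
  have hp : dressedKernel m mb αv av A Ab δ δ ≠ 0 := by
    rw [tauL_one m mb αv av A Ab hA hG δ hδ mδ nδ] at hτδ
    exact right_ne_zero_of_mul hτδ
  rw [det_kernel_cauchy_four _ x y u v α β γ δ hα hβ hγ hδ hαβ' hαγ' hαδ' hβγ' hβδ' hγδ'
    (fun s hs t ht => hw s t
      (by simp only [List.mem_cons, List.not_mem_nil, or_false] at hs
          rcases hs with rfl | rfl | rfl | rfl <;> assumption)
      (by simp only [List.mem_cons, List.not_mem_nil, or_false] at ht
          rcases ht with rfl | rfl | rfl | rfl <;> assumption)) hp] at t4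
  have hinv : ∀ p q : ℝ, (p + q) / (p - q) = ((p - q) * (p + q)⁻¹)⁻¹ := fun p q => by
    rw [mul_inv, inv_inv, mul_comm, div_eq_mul_inv]
  have hinv' : ∀ p q : ℝ, (q + p) / (q - p) = -((p - q) * (p + q)⁻¹)⁻¹ := fun p q => by
    rw [← hinv, ← neg_sub p q, div_neg, add_comm]
  rw [hinv' α β, hinv' α γ, hinv' β γ, hinv' α δ, hinv' β δ, hinv' γ δ, hinv α β, hinv α γ,
    hinv β γ]
  have f12 := mul_ne_zero hab (inv_ne_zero hαβ')
  have f13 := mul_ne_zero hac (inv_ne_zero hαγ')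
  have f14 := mul_ne_zero had (inv_ne_zero hαδ')
  have f23 := mul_ne_zero hbc (inv_ne_zero hβγ')
  have f24 := mul_ne_zero hbd (inv_ne_zero hβδ')
  have f34 := mul_ne_zero hcd (inv_ne_zero hγδ')
  generalize (α - β) * (α + β)⁻¹ = g12 at *
  generalize (α - γ) * (α + γ)⁻¹ = g13 at *
  generalize (α - δ) * (α + δ)⁻¹ = g14 at *
  generalize (β - γ) * (β + γ)⁻¹ = g23 at *
  generalize (β - δ) * (β + δ)⁻¹ = g24 at *
  generalize (γ - δ) * (γ + δ)⁻¹ = g34 at *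
  have p1 := congrArg₂ (· * ·) t12 t34
  have p2 := congrArg₂ (· * ·) t13 t24
  have p3 := congrArg₂ (· * ·) t14 t23
  beta_reduce at p1 p2 p3
  apply mul_right_cancel₀ (pow_ne_zero 2 (mul_ne_zero (mul_ne_zero (mul_ne_zero (mul_ne_zero
    (mul_ne_zero f12 f13) f14) f23) f24) f34))
  trans g12 * g13 * g24 * g34 * (tauL m mb A Ab [α, δ] * g14 ^ 2 * (tauL m mb A Ab [β, γ] * g23 ^ 2))
    - g12 * g23 * g14 * g34 * (tauL m mb A Ab [α, γ] * g13 ^ 2 * (tauL m mb A Ab [β, δ] * g24 ^ 2))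
    + g13 * g23 * g14 * g24 * (tauL m mb A Ab [α, β] * g12 ^ 2 * (tauL m mb A Ab [γ, δ] * g34 ^ 2))
  · rw [p1, p2, p3, mul_assoc, t4]
    ring
  · field_simp
    ring

end
end
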